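/- arXiv:1509.07883 — 2 statements merged into one kernel-verified Lean document; each statement's English description precedes it below -/
import Mathlib

section
/- Let A ∈ ℍ^{m×n} and W ∈ ℍ^{n×m} be such that WA ∈ ℍ^{n×n} is Hermitian, with k = max{Ind(AW), Ind(WA)} and rank(WA)^{k+1} = rank(WA)^k = r. Then the entries of the W-weighted Drazin inverse satisfy a^{d,W}_{ij} = [Σ_{α ∈ I_{r,n}{j}} rdet_j((((WA)^{k+2})_{j.}(ū_{i.}))^α_α)] / [Σ_{α ∈ I_{r,n}} |((WA)^{k+2})^α_α|] for all i = 1,…,m and j = 1,…,n, where ū_{i.} is the i-th row of Ū = A(WA)^k. -/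
open Matrix
open scoped Classical

noncomputable section

local notation "ℍ" => Quaternion ℝ

/-- The product of the entries of `A` along the `σ`-cycle of `j`, taken in forward
order starting at `j`:  `a_{j, σj} · a_{σj, σ²j} ⋯ a_{σ^{l-1}j, j}`. -/
def cycProd {n : ℕ} (A : Matrix (Fin n) (Fin n) ℍ) (σ : Equiv.Perm (Fin n)) (j : Fin n) : ℍ :=
  ((List.range (Function.minimalPeriod (⇑σ) j)).map
    fun t => A ((σ ^ t) j) ((σ ^ (t + 1)) j)).prod

/-- The minimal elements (leaders) of the `σ`-cycles not containing `i`, in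
increasing order. -/
def othersList {n : ℕ} (σ : Equiv.Perm (Fin n)) (i : Fin n) : List (Fin n) :=
  (Finset.univ.filter fun j =>
    ¬ σ.SameCycle i j ∧ ∀ t, σ.SameCycle j t → j ≤ t).sort (· ≤ ·)

/-- The `i`-th row determinant of a square quaternion matrix: the cycle containing
`i` is written first, starting at `i`; the remaining cycles follow, each starting at
its minimal element, ordered by increasing minimal elements; the sign `(-1)^{n-r}`
is the sign of the permutation. -/
def rdet {n : ℕ} (A : Matrix (Fin n) (Fin n) ℍ) (i : Fin n) : ℍ :=
  ∑ σ : Equiv.Perm (Fin n), ((Equiv.Perm.sign σ : ℤ) •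
    (cycProd A σ i * ((othersList σ i).map (cycProd A σ)).prod))

/-- The `j`-th column determinant of a square quaternion matrix (mirror convention:
the cycle containing `j` is written last, ending at `j`; the remaining cycles
precede it, ordered by decreasing minimal elements). -/
def cdet {n : ℕ} (A : Matrix (Fin n) (Fin n) ℍ) (j : Fin n) : ℍ :=
  ∑ σ : Equiv.Perm (Fin n), ((Equiv.Perm.sign σ : ℤ) •
    ((((othersList σ j).reverse.map (cycProd A σ)).prod) * cycProd A σ j))

/-- The determinant of a (Hermitian) quaternion matrix: all cycles ordered by
increasing minimal elements, each starting at its minimal element.  For Hermitian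
matrices this is the common value of all row and column determinants. -/
def qdet {n : ℕ} (A : Matrix (Fin n) (Fin n) ℍ) : ℍ :=
  ∑ σ : Equiv.Perm (Fin n), ((Equiv.Perm.sign σ : ℤ) •
    (((Finset.univ.filter fun j => ∀ t, σ.SameCycle j t → j ≤ t).sort (· ≤ ·)).map
      (cycProd A σ)).prod)

/-- The principal submatrix of `A` with rows and columns indexed by `β`. -/
def pSub {n : ℕ} (A : Matrix (Fin n) (Fin n) ℍ) (β : Finset (Fin n)) :
    Matrix (Fin β.card) (Fin β.card) ℍ :=
  fun a b => A ((β.orderIsoOfFin rfl) a) ((β.orderIsoOfFin rfl) b)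

/-- `|A^β_β|`, the determinant of the principal submatrix indexed by `β`. -/
def minorDet {n : ℕ} (A : Matrix (Fin n) (Fin n) ℍ) (β : Finset (Fin n)) : ℍ :=
  qdet (pSub A β)

/-- `cdet_i ((A)^β_β)` for `i ∈ β`. -/
def minorCdet {n : ℕ} (A : Matrix (Fin n) (Fin n) ℍ) (β : Finset (Fin n)) (i : Fin n) : ℍ :=
  if h : i ∈ β then cdet (pSub A β) ((β.orderIsoOfFin rfl).symm ⟨i, h⟩) else 0

/-- `rdet_j ((A)^α_α)` for `j ∈ α`. -/
def minorRdet {n : ℕ} (A : Matrix (Fin n) (Fin n) ℍ) (α : Finset (Fin n)) (j : Fin n) : ℍ :=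
  if h : j ∈ α then rdet (pSub A α) ((α.orderIsoOfFin rfl).symm ⟨j, h⟩) else 0

/-- The rank of a quaternion matrix: the dimension of its (left) row space. -/
def qrank {m n : ℕ} (A : Matrix (Fin m) (Fin n) ℍ) : ℕ :=
  Module.finrank ℍ (Submodule.span ℍ (Set.range A))

/-- `Ind A`: the smallest `k` with `rank A^{k+1} = rank A^k`. -/
def qindex {n : ℕ} (A : Matrix (Fin n) (Fin n) ℍ) : ℕ :=
  sInf {k | qrank (A ^ (k + 1)) = qrank (A ^ k)}

/-- `X` is the Moore–Penrose inverse of `A`. -/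
def IsMP {m n : ℕ} (A : Matrix (Fin m) (Fin n) ℍ) (X : Matrix (Fin n) (Fin m) ℍ) : Prop :=
  A * X * A = A ∧ X * A * X = X ∧ (A * X)ᴴ = A * X ∧ (X * A)ᴴ = X * A

/-- `X` is the Drazin inverse of `A`. -/
def IsDrazin {n : ℕ} (A X : Matrix (Fin n) (Fin n) ℍ) : Prop :=
  X * A * X = X ∧ A * X = X * A ∧ A ^ (qindex A + 1) * X = A ^ qindex A

/-- `X` is the W-weighted Drazin inverse of `A` with respect to `W`. -/
def IsWDrazin {m n : ℕ} (A : Matrix (Fin m) (Fin n) ℍ) (W : Matrix (Fin n) (Fin m) ℍ)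
    (X : Matrix (Fin m) (Fin n) ℍ) : Prop :=
  (A * W) ^ (max (qindex (A * W)) (qindex (W * A)) + 1) * X * W
      = (A * W) ^ max (qindex (A * W)) (qindex (W * A)) ∧
  X * W * A * W * X = X ∧ A * W * X = X * W * A

section CycleProducts

variable {n : ℕ}

lemma sameCycle_iff_exists_nat_pow (σ : Equiv.Perm (Fin n)) (a b : Fin n) :
    σ.SameCycle a b ↔ ∃ t : ℕ, (σ ^ t) a = b :=
  ⟨fun h => by obtain ⟨t, -, ht⟩ := h.exists_pow_eq'; exact ⟨t, ht⟩,
    fun ⟨t, ht⟩ => ⟨t, by simpa using ht⟩⟩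

lemma pow_minimalPeriod_apply (σ : Equiv.Perm (Fin n)) (a : Fin n) :
    (σ ^ Function.minimalPeriod (⇑σ) a) a = a := by
  have h := Function.isPeriodicPt_minimalPeriod (⇑σ) a
  rwa [Function.IsPeriodicPt, Function.IsFixedPt, ← Equiv.Perm.coe_pow] at h

lemma minimalPeriod_perm_pos (σ : Equiv.Perm (Fin n)) (a : Fin n) :
    0 < Function.minimalPeriod (⇑σ) a := by
  refine Function.minimalPeriod_pos_of_mem_periodicPts ⟨orderOf σ, orderOf_pos σ, ?_⟩
  rw [Function.IsPeriodicPt, Function.IsFixedPt, ← Equiv.Perm.coe_pow, pow_orderOf_eq_one]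
  rfl

lemma pow_apply_ne_of_lt_minimalPeriod (σ : Equiv.Perm (Fin n)) (a : Fin n) {t : ℕ}
    (h0 : t ≠ 0) (ht : t < Function.minimalPeriod (⇑σ) a) : (σ ^ t) a ≠ a := by
  have h := Function.not_isPeriodicPt_of_pos_of_lt_minimalPeriod h0 ht
  rwa [Function.IsPeriodicPt, Function.IsFixedPt, ← Equiv.Perm.coe_pow] at h

lemma exists_pow_lt_of_sameCycle {σ : Equiv.Perm (Fin n)} {a b : Fin n}
    (h : σ.SameCycle a b) : ∃ t < Function.minimalPeriod (⇑σ) a, (σ ^ t) a = b := by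
  obtain ⟨t, rfl⟩ := (sameCycle_iff_exists_nat_pow σ a b).1 h
  refine ⟨t % Function.minimalPeriod (⇑σ) a, Nat.mod_lt _ (minimalPeriod_perm_pos σ a), ?_⟩
  simpa only [Equiv.Perm.coe_pow] using Function.iterate_mod_minimalPeriod_eq (f := ⇑σ) (x := a)

lemma exists_pow_pos_le_of_sameCycle {σ : Equiv.Perm (Fin n)} {a b : Fin n}
    (h : σ.SameCycle a b) :
    ∃ t, t ≠ 0 ∧ t ≤ Function.minimalPeriod (⇑σ) a ∧ (σ ^ t) a = b := by
  obtain ⟨t, ht, rfl⟩ := exists_pow_lt_of_sameCycle h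
  rcases Nat.eq_zero_or_pos t with rfl | h0
  · exact ⟨_, (minimalPeriod_perm_pos σ a).ne', le_rfl, by simp [pow_minimalPeriod_apply]⟩
  · exact ⟨t, h0.ne', ht.le, rfl⟩

lemma minimalPeriod_eq_of_pow {N : ℕ} {σ : Equiv.Perm (Fin n)} {τ : Equiv.Perm (Fin N)}
    {a : Fin n} {b : Fin N} (h : ∀ t : ℕ, (σ ^ t) a = a ↔ (τ ^ t) b = b) :
    Function.minimalPeriod (⇑σ) a = Function.minimalPeriod (⇑τ) b := by
  rw [Function.minimalPeriod_eq_minimalPeriod_iff]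
  intro t
  simpa only [Function.IsPeriodicPt, Function.IsFixedPt, ← Equiv.Perm.coe_pow] using h t

lemma pow_apply_eq_of_eqOn_cycle {σ τ : Equiv.Perm (Fin n)} {a : Fin n}
    (h : ∀ x, σ.SameCycle a x → τ x = σ x) (t : ℕ) : (τ ^ t) a = (σ ^ t) a := by
  induction t with
  | zero => rfl
  | succ t ih =>
    rw [pow_succ', pow_succ', Equiv.Perm.mul_apply, Equiv.Perm.mul_apply, ih]
    exact h _ ((sameCycle_iff_exists_nat_pow _ _ _).2 ⟨t, rfl⟩)

lemma sameCycle_iff_of_eqOn_cycle {σ τ : Equiv.Perm (Fin n)} {a : Fin n}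
    (h : ∀ x, σ.SameCycle a x → τ x = σ x) (b : Fin n) :
    τ.SameCycle a b ↔ σ.SameCycle a b := by
  simp only [sameCycle_iff_exists_nat_pow, pow_apply_eq_of_eqOn_cycle h]

lemma cycProd_eq_of_eqOn_cycle {σ τ : Equiv.Perm (Fin n)} {a : Fin n}
    {A B : Matrix (Fin n) (Fin n) ℍ}
    (h : ∀ x, σ.SameCycle a x → τ x = σ x) (hAB : ∀ x, σ.SameCycle a x → A x = B x) :
    cycProd A τ a = cycProd B σ a := by
  have hp : Function.minimalPeriod (⇑τ) a = Function.minimalPeriod (⇑σ) a :=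
    minimalPeriod_eq_of_pow fun t => by rw [pow_apply_eq_of_eqOn_cycle h]
  rw [cycProd, cycProd, hp]
  refine congrArg List.prod (List.map_congr_left fun t _ => ?_)
  rw [pow_apply_eq_of_eqOn_cycle h, pow_apply_eq_of_eqOn_cycle h,
    hAB _ ((sameCycle_iff_exists_nat_pow _ _ _).2 ⟨t, rfl⟩)]

lemma quaternion_re_mul_comm (a b : ℍ) : (a * b).re = (b * a).re := by
  simp only [Quaternion.re_mul]; ring

lemma re_cycProd_apply (A : Matrix (Fin n) (Fin n) ℍ) (σ : Equiv.Perm (Fin n)) (a : Fin n) :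
    (cycProd A σ (σ a)).re = (cycProd A σ a).re := by
  have hp : Function.minimalPeriod (⇑σ) (σ a) = Function.minimalPeriod (⇑σ) a :=
    minimalPeriod_eq_of_pow fun t => by
      rw [← Equiv.Perm.mul_apply, ← pow_succ, pow_succ', Equiv.Perm.mul_apply,
        σ.injective.eq_iff]
  obtain ⟨L, hL⟩ := Nat.exists_eq_succ_of_ne_zero (minimalPeriod_perm_pos σ a).ne'
  have hL' : (σ ^ (L + 1)) a = a := by
    have := pow_minimalPeriod_apply σ a
    rwa [hL] at this
  rw [cycProd, cycProd, hp, hL, Nat.succ_eq_add_one]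
  conv_lhs => rw [List.range_succ]
  conv_rhs => rw [List.range_succ_eq_map]
  rw [List.map_append, List.prod_append, List.map_cons, List.prod_cons, quaternion_re_mul_comm]
  simp only [List.map_map, List.map_cons, List.map_nil, List.prod_cons, List.prod_nil, mul_one,
    Function.comp_def, ← Equiv.Perm.mul_apply, ← pow_succ, Nat.succ_eq_add_one]
  rw [pow_succ' σ (L + 1), Equiv.Perm.mul_apply, hL']
  simp

lemma re_cycProd_eq_of_sameCycle (A : Matrix (Fin n) (Fin n) ℍ) {σ : Equiv.Perm (Fin n)}
    {a b : Fin n} (h : σ.SameCycle a b) : (cycProd A σ b).re = (cycProd A σ a).re := by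
  obtain ⟨t, rfl⟩ := (sameCycle_iff_exists_nat_pow σ a b).1 h
  clear h
  induction t with
  | zero => rfl
  | succ t ih => rw [pow_succ', Equiv.Perm.mul_apply, re_cycProd_apply, ih]

/-- The permutation obtained from `σ` by inverting the cycle through `p`. -/
def invertCycle (p : Fin n) (σ : Equiv.Perm (Fin n)) : Equiv.Perm (Fin n) :=
  σ * (σ.cycleOf p)⁻¹ * (σ.cycleOf p)⁻¹

lemma sign_invertCycle (p : Fin n) (σ : Equiv.Perm (Fin n)) :
    Equiv.Perm.sign (invertCycle p σ) = Equiv.Perm.sign σ := by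
  rw [invertCycle, Equiv.Perm.sign_mul, Equiv.Perm.sign_mul, mul_assoc, Int.units_mul_self,
    mul_one]

lemma invertCycle_apply_of_sameCycle {p x : Fin n} {σ : Equiv.Perm (Fin n)}
    (h : σ.SameCycle p x) : invertCycle p σ x = σ⁻¹ x := by
  have h' : σ.SameCycle p (σ⁻¹ x) := Equiv.Perm.sameCycle_symm_apply_right.2 h
  have key : ∀ y, σ.SameCycle p y → (σ.cycleOf p)⁻¹ y = σ⁻¹ y := fun y hy => by
    rw [Equiv.Perm.inv_eq_iff_eq, Equiv.Perm.SameCycle.cycleOf_apply]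
    · simp
    · exact Equiv.Perm.sameCycle_symm_apply_right.2 hy
  rw [invertCycle, Equiv.Perm.mul_apply, Equiv.Perm.mul_apply, key x h, key _ h']
  simp

lemma invertCycle_apply_of_not_sameCycle {p x : Fin n} {σ : Equiv.Perm (Fin n)}
    (h : ¬ σ.SameCycle p x) : invertCycle p σ x = σ x := by
  have key : (σ.cycleOf p)⁻¹ x = x := by
    rw [Equiv.Perm.inv_eq_iff_eq, Equiv.Perm.cycleOf_apply_of_not_sameCycle h]
  rw [invertCycle, Equiv.Perm.mul_apply, Equiv.Perm.mul_apply, key, key]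

lemma pow_invertCycle_apply {p a : Fin n} {σ : Equiv.Perm (Fin n)} (h : σ.SameCycle p a)
    (t : ℕ) : (invertCycle p σ ^ t) a = ((σ⁻¹) ^ t) a := by
  refine pow_apply_eq_of_eqOn_cycle (fun x hx => invertCycle_apply_of_sameCycle ?_) t
  exact h.trans (Equiv.Perm.sameCycle_inv.1 hx)

lemma sameCycle_invertCycle (p : Fin n) (σ : Equiv.Perm (Fin n)) (a b : Fin n) :
    (invertCycle p σ).SameCycle a b ↔ σ.SameCycle a b := by
  by_cases h : σ.SameCycle p a
  · rw [← Equiv.Perm.sameCycle_inv (f := σ)]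
    simp only [sameCycle_iff_exists_nat_pow, pow_invertCycle_apply h]
  · exact sameCycle_iff_of_eqOn_cycle (fun x hx => invertCycle_apply_of_not_sameCycle
      fun hpx => h (hpx.trans hx.symm)) b

lemma invertCycle_invertCycle (p : Fin n) (σ : Equiv.Perm (Fin n)) :
    invertCycle p (invertCycle p σ) = σ := by
  ext1 x
  by_cases h : σ.SameCycle p x
  · rw [invertCycle_apply_of_sameCycle ((sameCycle_invertCycle p σ p x).2 h),
      Equiv.Perm.inv_eq_iff_eq, invertCycle_apply_of_sameCycle
        (Equiv.Perm.sameCycle_apply_right.2 h)]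
    simp
  · rw [invertCycle_apply_of_not_sameCycle (fun h' => h ((sameCycle_invertCycle p σ p x).1 h')),
      invertCycle_apply_of_not_sameCycle h]

lemma cycProd_invertCycle_of_not_sameCycle (A : Matrix (Fin n) (Fin n) ℍ) {p a : Fin n}
    {σ : Equiv.Perm (Fin n)} (h : ¬ σ.SameCycle p a) :
    cycProd A (invertCycle p σ) a = cycProd A σ a :=
  cycProd_eq_of_eqOn_cycle (fun _ hx => invertCycle_apply_of_not_sameCycle
    fun hpx => h (hpx.trans hx.symm)) fun _ _ => rfl

lemma star_list_prod_quaternion (l : List ℍ) : star l.prod = (l.map star).reverse.prod := by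
  induction l with
  | nil => simp
  | cons a l ih => simp [ih]

lemma reverse_range_map {β : Type*} (N : ℕ) (f : ℕ → β) :
    ((List.range N).map f).reverse = (List.range N).map fun t => f (N - 1 - t) := by
  apply List.ext_getElem
  · simp
  · intro i h1 h2
    simp

lemma cycProd_invertCycle_of_sameCycle {A : Matrix (Fin n) (Fin n) ℍ} (hA : Aᴴ = A)
    {p a : Fin n} {σ : Equiv.Perm (Fin n)} (h : σ.SameCycle p a) :
    cycProd A (invertCycle p σ) a = star (cycProd A σ a) := by
  have hp : Function.minimalPeriod (⇑(invertCycle p σ)) a = Function.minimalPeriod (⇑σ) a :=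
    minimalPeriod_eq_of_pow fun t => by
      rw [pow_invertCycle_apply h, inv_pow, Equiv.Perm.inv_eq_iff_eq, eq_comm]
  have key : ∀ t ≤ Function.minimalPeriod (⇑σ) a,
      (invertCycle p σ ^ t) a = (σ ^ (Function.minimalPeriod (⇑σ) a - t)) a := fun t ht => by
    rw [pow_invertCycle_apply h, inv_pow, Equiv.Perm.inv_eq_iff_eq, ← Equiv.Perm.mul_apply,
      ← pow_add, Nat.add_sub_cancel' ht, pow_minimalPeriod_apply]
  rw [cycProd, cycProd, hp, star_list_prod_quaternion, List.map_map, reverse_range_map]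
  refine congrArg List.prod (List.map_congr_left fun t ht => ?_)
  have ht' := List.mem_range.1 ht
  rw [key t ht'.le, key (t + 1) ht', Function.comp_apply, ← Matrix.conjTranspose_apply, hA]
  congr 3 <;> omega

lemma re_cycProd_invertCycle {A : Matrix (Fin n) (Fin n) ℍ} (hA : Aᴴ = A)
    (p a : Fin n) (σ : Equiv.Perm (Fin n)) :
    (cycProd A (invertCycle p σ) a).re = (cycProd A σ a).re := by
  by_cases h : σ.SameCycle p a
  · rw [cycProd_invertCycle_of_sameCycle hA h, Quaternion.re_star]
  · rw [cycProd_invertCycle_of_not_sameCycle A h]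

end CycleProducts


section Swap

variable {n : ℕ} {σ : Equiv.Perm (Fin n)} {j s : Fin n}

lemma ne_of_not_sameCycle (h : ¬ σ.SameCycle j s) : j ≠ s :=
  fun e => h (e ▸ Equiv.Perm.SameCycle.refl σ j)

lemma pow_mul_swap_apply_first (h : ¬ σ.SameCycle j s) {t : ℕ} (h0 : t ≠ 0)
    (ht : t ≤ Function.minimalPeriod (⇑σ) s) :
    ((σ * Equiv.swap j s) ^ t) j = (σ ^ t) s := by
  induction t with
  | zero => exact absurd rfl h0
  | succ t ih =>
    rcases Nat.eq_zero_or_pos t with rfl | hpos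
    · simp
    · rw [pow_succ', pow_succ', Equiv.Perm.mul_apply, Equiv.Perm.mul_apply, ih hpos.ne' (by omega),
        Equiv.Perm.mul_apply, Equiv.swap_apply_of_ne_of_ne]
      · intro e
        exact h ((sameCycle_iff_exists_nat_pow _ _ _).2 ⟨t, e⟩).symm
      · exact pow_apply_ne_of_lt_minimalPeriod σ s hpos.ne' (by omega)

lemma pow_mul_swap_apply_period (h : ¬ σ.SameCycle j s) :
    ((σ * Equiv.swap j s) ^ Function.minimalPeriod (⇑σ) s) j = s := by
  rw [pow_mul_swap_apply_first h (minimalPeriod_perm_pos σ s).ne' le_rfl,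
    pow_minimalPeriod_apply]

lemma pow_mul_swap_apply_second (h : ¬ σ.SameCycle j s) {t : ℕ} (h0 : t ≠ 0)
    (ht : t ≤ Function.minimalPeriod (⇑σ) j) :
    ((σ * Equiv.swap j s) ^ (Function.minimalPeriod (⇑σ) s + t)) j = (σ ^ t) j := by
  rw [add_comm, pow_add, Equiv.Perm.mul_apply, pow_mul_swap_apply_period h, Equiv.swap_comm]
  exact pow_mul_swap_apply_first (fun h' => h h'.symm) h0 ht

lemma minimalPeriod_mul_swap (h : ¬ σ.SameCycle j s) :
    Function.minimalPeriod (⇑(σ * Equiv.swap j s)) j =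
      Function.minimalPeriod (⇑σ) s + Function.minimalPeriod (⇑σ) j := by
  have hs := minimalPeriod_perm_pos σ s
  have hj := minimalPeriod_perm_pos σ j
  have hpos := minimalPeriod_perm_pos (σ * Equiv.swap j s) j
  have hper := pow_minimalPeriod_apply (σ * Equiv.swap j s) j
  apply le_antisymm
  · refine Function.IsPeriodicPt.minimalPeriod_le (by omega) ?_
    rw [Function.IsPeriodicPt, Function.IsFixedPt, ← Equiv.Perm.coe_pow,
      pow_mul_swap_apply_second h hj.ne' le_rfl, pow_minimalPeriod_apply]
  · by_contra! hlt
    rcases le_or_gt (Function.minimalPeriod (⇑(σ * Equiv.swap j s)) j)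
      (Function.minimalPeriod (⇑σ) s) with hle | hgt
    · rw [pow_mul_swap_apply_first h hpos.ne' hle] at hper
      exact h ((sameCycle_iff_exists_nat_pow _ _ _).2 ⟨_, hper⟩).symm
    · obtain ⟨t, ht⟩ := Nat.exists_eq_add_of_lt hgt
      rw [ht, add_assoc, pow_mul_swap_apply_second h (by omega) (by omega)] at hper
      exact pow_apply_ne_of_lt_minimalPeriod σ j (by omega) (by omega) hper

lemma cycProd_mul_swap (M : Matrix (Fin n) (Fin n) ℍ) (v : Fin n → ℍ)
    (h : ¬ σ.SameCycle j s) :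
    cycProd (M.updateRow j v) (σ * Equiv.swap j s) j =
      cycProd (M.updateRow s v) σ s * cycProd (M.updateRow j (M s)) σ j := by
  have hs := minimalPeriod_perm_pos σ s
  rw [cycProd, minimalPeriod_mul_swap h, List.range_add, List.map_append, List.prod_append,
    List.map_map]
  congr 2
  · refine List.map_congr_left fun t ht => ?_
    have ht' := List.mem_range.1 ht
    rw [pow_mul_swap_apply_first h t.succ_ne_zero ht']
    rcases Nat.eq_zero_or_pos t with rfl | hpos
    · simp
    · rw [pow_mul_swap_apply_first h hpos.ne' ht'.le, Matrix.updateRow_ne, Matrix.updateRow_ne]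
      · exact pow_apply_ne_of_lt_minimalPeriod σ s hpos.ne' ht'
      · intro e
        exact h ((sameCycle_iff_exists_nat_pow _ _ _).2 ⟨t, e⟩).symm
  · refine List.map_congr_left fun t ht => ?_
    have ht' := List.mem_range.1 ht
    rw [Function.comp_apply, add_assoc, pow_mul_swap_apply_second h t.succ_ne_zero ht']
    rcases Nat.eq_zero_or_pos t with rfl | hpos
    · simp [pow_mul_swap_apply_period h, Matrix.updateRow_ne (ne_of_not_sameCycle h).symm]
    · rw [pow_mul_swap_apply_second h hpos.ne' ht'.le]
      rw [Matrix.updateRow_ne, Matrix.updateRow_ne] <;>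
      exact pow_apply_ne_of_lt_minimalPeriod σ j hpos.ne' ht'

lemma mul_swap_apply_of_not_sameCycle {x : Fin n} (hj : ¬ σ.SameCycle j x)
    (hs : ¬ σ.SameCycle s x) : (σ * Equiv.swap j s) x = σ x := by
  rw [Equiv.Perm.mul_apply, Equiv.swap_apply_of_ne_of_ne (ne_of_not_sameCycle hj).symm
    (ne_of_not_sameCycle hs).symm]

lemma sameCycle_mul_swap_of_not_sameCycle {x : Fin n} (hj : ¬ σ.SameCycle j x)
    (hs : ¬ σ.SameCycle s x) (y : Fin n) :
    (σ * Equiv.swap j s).SameCycle x y ↔ σ.SameCycle x y :=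
  sameCycle_iff_of_eqOn_cycle (fun _ hz => mul_swap_apply_of_not_sameCycle
    (fun h => hj (h.trans hz.symm)) fun h => hs (h.trans hz.symm)) y

lemma cycProd_mul_swap_of_not_sameCycle (M : Matrix (Fin n) (Fin n) ℍ) {x : Fin n}
    (hj : ¬ σ.SameCycle j x) (hs : ¬ σ.SameCycle s x) :
    cycProd M (σ * Equiv.swap j s) x = cycProd M σ x :=
  cycProd_eq_of_eqOn_cycle (fun _ hz => mul_swap_apply_of_not_sameCycle
    (fun h => hj (h.trans hz.symm)) fun h => hs (h.trans hz.symm)) fun _ _ => rfl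

lemma sameCycle_mul_swap_iff (h : ¬ σ.SameCycle j s) (x : Fin n) :
    (σ * Equiv.swap j s).SameCycle j x ↔ σ.SameCycle j x ∨ σ.SameCycle s x := by
  constructor
  · intro hx
    by_contra! hc
    have h' := (sameCycle_mul_swap_of_not_sameCycle hc.1 hc.2 j).1 hx.symm
    exact hc.1 h'.symm
  · rintro (hx | hx)
    · obtain ⟨t, h0, ht, rfl⟩ := exists_pow_pos_le_of_sameCycle hx
      exact (sameCycle_iff_exists_nat_pow _ _ _).2 ⟨_, pow_mul_swap_apply_second h h0 ht⟩
    · obtain ⟨t, h0, ht, rfl⟩ := exists_pow_pos_le_of_sameCycle hx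
      exact (sameCycle_iff_exists_nat_pow _ _ _).2 ⟨_, pow_mul_swap_apply_first h h0 ht⟩

lemma sameCycle_mul_swap (h : ¬ σ.SameCycle j s) : (σ * Equiv.swap j s).SameCycle j s :=
  (sameCycle_mul_swap_iff h s).2 (Or.inr (Equiv.Perm.SameCycle.refl σ s))

lemma not_sameCycle_mul_swap (hne : j ≠ s) (h : σ.SameCycle j s) :
    ¬ (σ * Equiv.swap j s).SameCycle j s := by
  have hex := (sameCycle_iff_exists_nat_pow σ j s).1 h
  obtain ⟨k, hk, hks⟩ := exists_pow_lt_of_sameCycle h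
  have hk0 : k ≠ 0 := by rintro rfl; exact hne (by simpa using hks)
  have hinj : ∀ t, t < k → (σ ^ t) j ≠ s := fun t ht e => by
    have := Function.le_of_lt_minimalPeriod_of_iterate_eq (f := ⇑σ) (x := j) hk (n := t)
      (by simpa only [← Equiv.Perm.coe_pow, e] using hks)
    omega
  have key : ∀ t, t ≠ 0 → t ≤ k → ((σ * Equiv.swap j s) ^ t) s = (σ ^ t) j := by
    intro t
    induction t with
    | zero => intro h0; exact absurd rfl h0
    | succ t ih =>
      intro _ ht
      rcases Nat.eq_zero_or_pos t with rfl | hpos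
      · simp
      · rw [pow_succ', pow_succ', Equiv.Perm.mul_apply, Equiv.Perm.mul_apply,
          ih hpos.ne' (by omega), Equiv.Perm.mul_apply, Equiv.swap_apply_of_ne_of_ne]
        · exact pow_apply_ne_of_lt_minimalPeriod σ j hpos.ne' (by omega)
        · exact hinj t (by omega)
  have hper : ((σ * Equiv.swap j s) ^ k) s = s := by rw [key k hk0 le_rfl, hks]
  intro hc
  obtain ⟨t, ht, hts⟩ := exists_pow_lt_of_sameCycle hc.symm
  have hle : Function.minimalPeriod (⇑(σ * Equiv.swap j s)) s ≤ k := by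
    refine Function.IsPeriodicPt.minimalPeriod_le (Nat.pos_of_ne_zero hk0) ?_
    rwa [Function.IsPeriodicPt, Function.IsFixedPt, ← Equiv.Perm.coe_pow]
  have ht0 : t ≠ 0 := by rintro rfl; exact hne (by simpa using hts.symm)
  rw [key t ht0 (by omega)] at hts
  exact pow_apply_ne_of_lt_minimalPeriod σ j ht0 (by omega) hts

lemma sign_mul_swap (hne : j ≠ s) :
    Equiv.Perm.sign (σ * Equiv.swap j s) = - Equiv.Perm.sign σ := by
  rw [Equiv.Perm.sign_mul, Equiv.Perm.sign_swap hne, mul_neg, mul_one]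

end Swap

section RealParts

variable {n : ℕ}

lemma list_prod_add_list_prod {ι : Type*} {p : ι} (f g h : ι → ℍ) :
    ∀ L : List ι, L.Nodup → p ∈ L → (∀ x ∈ L, x ≠ p → f x = h x ∧ g x = h x) →
      f p + g p = (2 : ℕ) • h p →
      (L.map f).prod + (L.map g).prod = (2 : ℕ) • (L.map h).prod := by
  intro L
  induction L with
  | nil => intro _ hp; simp at hp
  | cons a L ih =>
    intro hnd hp hfg hsum
    rw [List.nodup_cons] at hnd
    by_cases ha : a = p
    · subst ha
      have hf : L.map f = L.map h := List.map_congr_left fun x hx =>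
        (hfg x (List.mem_cons_of_mem _ hx) fun e => hnd.1 (e ▸ hx)).1
      have hg : L.map g = L.map h := List.map_congr_left fun x hx =>
        (hfg x (List.mem_cons_of_mem _ hx) fun e => hnd.1 (e ▸ hx)).2
      simp only [List.map_cons, List.prod_cons]
      rw [hf, hg, ← add_mul, hsum, smul_mul_assoc]
    · have hpL : p ∈ L := (List.mem_cons.1 hp).resolve_left fun e => ha e.symm
      have h1 := hfg a List.mem_cons_self ha
      simp only [List.map_cons, List.prod_cons]
      rw [h1.1, h1.2, ← mul_add, ih hnd.2 hpL (fun x hx => hfg x (List.mem_cons_of_mem _ hx)) hsum,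
        mul_smul_comm]

lemma sum_sign_smul_eq_of_involution {P : Finset (Equiv.Perm (Fin n))}
    (ψ : Equiv.Perm (Fin n) → Equiv.Perm (Fin n)) (hψ : ∀ σ, ψ (ψ σ) = σ)
    (hP : ∀ σ ∈ P, ψ σ ∈ P) (hs : ∀ σ, Equiv.Perm.sign (ψ σ) = Equiv.Perm.sign σ)
    (F G : Equiv.Perm (Fin n) → ℍ) (h : ∀ σ ∈ P, F σ + F (ψ σ) = (2 : ℕ) • G σ) :
    ∑ σ ∈ P, (Equiv.Perm.sign σ : ℤ) • F σ = ∑ σ ∈ P, (Equiv.Perm.sign σ : ℤ) • G σ := by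
  have h1 : ∑ σ ∈ P, (Equiv.Perm.sign σ : ℤ) • F σ =
      ∑ σ ∈ P, (Equiv.Perm.sign σ : ℤ) • F (ψ σ) :=
    Finset.sum_nbij' ψ ψ hP hP (fun σ _ => hψ σ) (fun σ _ => hψ σ)
      (fun σ _ => by rw [hs, hψ])
  have h2 : (2 : ℍ) ≠ 0 := by
    rw [← map_ofNat (algebraMap ℝ ℍ) 2]
    exact (map_ne_zero _).2 two_ne_zero
  refine mul_left_cancel₀ h2 ?_
  conv_lhs => rw [two_mul]
  nth_rewrite 2 [h1]
  rw [← Finset.sum_add_distrib, ← Nat.cast_two, ← nsmul_eq_mul, Finset.smul_sum]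
  refine Finset.sum_congr rfl fun σ hσ => ?_
  rw [← smul_add, h σ hσ, smul_comm]

lemma add_star_eq_two_nsmul_re (z : ℍ) : z + star z = (2 : ℕ) • ((z.re : ℝ) : ℍ) := by
  ext <;> simp [two_mul]

lemma sum_list_prod_eq_sum_re {M : Matrix (Fin n) (Fin n) ℍ} (hM : Mᴴ = M)
    (a : Equiv.Perm (Fin n) → ℍ) (L : Equiv.Perm (Fin n) → List (Fin n))
    (hnd : ∀ σ, (L σ).Nodup)
    (hdisj : ∀ σ, ∀ x ∈ L σ, ∀ y ∈ L σ, σ.SameCycle x y → x = y)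
    (hL : ∀ σ p, p ∈ L σ → L (invertCycle p σ) = L σ)
    (ha : ∀ σ p, p ∈ L σ → a (invertCycle p σ) = a σ) :
    ∑ σ, (Equiv.Perm.sign σ : ℤ) • (a σ * ((L σ).map (cycProd M σ)).prod) =
      ∑ σ, (Equiv.Perm.sign σ : ℤ) •
        (a σ * ((L σ).map fun l => (((cycProd M σ l).re : ℝ) : ℍ)).prod) := by
  suffices H : ∀ S : Finset (Fin n),
      ∑ σ, (Equiv.Perm.sign σ : ℤ) • (a σ * ((L σ).map (cycProd M σ)).prod) =
      ∑ σ, (Equiv.Perm.sign σ : ℤ) • (a σ * ((L σ).map fun l =>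
        if l ∈ S then (((cycProd M σ l).re : ℝ) : ℍ) else cycProd M σ l).prod) by
    simpa using H Finset.univ
  intro S
  induction S using Finset.induction_on with
  | empty => simp
  | insert p S hp ih =>
    rw [ih]
    have hmem : ∀ σ, p ∈ L (invertCycle p σ) → p ∈ L σ := fun σ h => by
      have := hL _ p h
      rw [invertCycle_invertCycle] at this
      rwa [this]
    refine sum_sign_smul_eq_of_involution
      (fun σ => if p ∈ L σ then invertCycle p σ else σ) ?_ (fun _ _ => Finset.mem_univ _) ?_ _ _ ?_
    · intro σ
      by_cases h : p ∈ L σ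
      · simp [h, hL σ p h, invertCycle_invertCycle]
      · simp [h]
    · intro σ
      by_cases h : p ∈ L σ
      · simp [h, sign_invertCycle]
      · simp [h]
    · intro σ _
      by_cases h : p ∈ L σ
      · simp only [if_pos h]
        rw [ha σ p h, hL σ p h, ← mul_add, list_prod_add_list_prod (p := p) _ _ _ (L σ) (hnd σ) h,
          mul_smul_comm]
        · intro x hx hxp
          have hns : ¬ σ.SameCycle p x := fun hc => hxp (hdisj σ p h x hx hc).symm
          rw [cycProd_invertCycle_of_not_sameCycle M hns]
          simp [Finset.mem_insert, hxp]
        · rw [cycProd_invertCycle_of_sameCycle hM (Equiv.Perm.SameCycle.refl σ p)]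
          simp only [if_neg hp, Finset.mem_insert_self, if_true]
          exact add_star_eq_two_nsmul_re _
      · simp only [if_neg h]
        rw [two_nsmul]
        have : (L σ).map (fun l => if l ∈ insert p S then (((cycProd M σ l).re : ℝ) : ℍ)
            else cycProd M σ l) = (L σ).map (fun l => if l ∈ S then (((cycProd M σ l).re : ℝ) : ℍ)
            else cycProd M σ l) := by
          refine List.map_congr_left fun x hx => ?_
          have hxp : x ≠ p := fun e => h (e ▸ hx)
          simp [Finset.mem_insert, hxp]
        rw [this]

lemma quaternion_coe_eq_algebraMap (x : ℝ) : (x : ℍ) = algebraMap ℝ ℍ x := rfl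

lemma list_sort_map_coe_prod (s : Finset (Fin n)) (f : Fin n → ℝ) :
    ((s.sort (· ≤ ·)).map fun l => ((f l : ℝ) : ℍ)).prod = ((∏ l ∈ s, f l : ℝ) : ℍ) := by
  have h1 : ((s.sort (· ≤ ·)).map f).prod = ∏ l ∈ s, f l := by
    conv_rhs => rw [Finset.prod_eq_multiset_prod, ← Finset.sort_eq s (· ≤ ·), Multiset.map_coe,
      Multiset.prod_coe]
  rw [← h1, quaternion_coe_eq_algebraMap, map_list_prod, List.map_map]
  rfl

/-- `j` is the least element of its `σ`-cycle. -/
def IsCycleMin (σ : Equiv.Perm (Fin n)) (j : Fin n) : Prop := ∀ t, σ.SameCycle j t → j ≤ t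

lemma IsCycleMin.eq {σ : Equiv.Perm (Fin n)} {x y : Fin n} (hx : IsCycleMin σ x)
    (hy : IsCycleMin σ y) (h : σ.SameCycle x y) : x = y :=
  le_antisymm (hx y h) (hy x h.symm)

lemma isCycleMin_invertCycle (p : Fin n) (σ : Equiv.Perm (Fin n)) (x : Fin n) :
    IsCycleMin (invertCycle p σ) x ↔ IsCycleMin σ x := by
  simp only [IsCycleMin, sameCycle_invertCycle]

lemma rdet_updateRow_eq_sum {M : Matrix (Fin n) (Fin n) ℍ} (hM : Mᴴ = M) (j : Fin n)
    (v : Fin n → ℍ) :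
    rdet (M.updateRow j v) j = ∑ σ : Equiv.Perm (Fin n), (Equiv.Perm.sign σ : ℤ) •
      (cycProd (M.updateRow j v) σ j *
        ((∏ l ∈ Finset.univ.filter (fun l => ¬ σ.SameCycle j l ∧ IsCycleMin σ l),
          (cycProd M σ l).re : ℝ) : ℍ)) := by
  have hmem : ∀ (σ : Equiv.Perm (Fin n)) x, x ∈ othersList σ j ↔
      ¬ σ.SameCycle j x ∧ IsCycleMin σ x := fun σ x => by
    simp [othersList, IsCycleMin]
  have h1 : rdet (M.updateRow j v) j = ∑ σ : Equiv.Perm (Fin n), (Equiv.Perm.sign σ : ℤ) •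
      (cycProd (M.updateRow j v) σ j * ((othersList σ j).map (cycProd M σ)).prod) := by
    refine Finset.sum_congr rfl fun σ _ => ?_
    congr 3
    refine List.map_congr_left fun l hl => ?_
    refine cycProd_eq_of_eqOn_cycle (fun _ _ => rfl) fun x hx => ?_
    funext y
    rw [Matrix.updateRow_ne]
    rintro rfl
    exact ((hmem σ l).1 hl).1 hx.symm
  rw [h1, sum_list_prod_eq_sum_re hM]
  · refine Finset.sum_congr rfl fun σ _ => ?_
    have e : Finset.univ.filter (fun l => ¬ σ.SameCycle j l ∧ IsCycleMin σ l) =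
        Finset.univ.filter fun l => ¬ σ.SameCycle j l ∧ ∀ t, σ.SameCycle l t → l ≤ t := by
      ext l; simp only [Finset.mem_filter]; rfl
    rw [othersList, list_sort_map_coe_prod, e]
  · exact fun σ => Finset.sort_nodup _ _
  · intro σ x hx y hy h
    exact ((hmem σ x).1 hx).2.eq ((hmem σ y).1 hy).2 h
  · intro σ p _
    simp only [othersList, sameCycle_invertCycle]
  · intro σ p hp
    exact cycProd_invertCycle_of_not_sameCycle _ fun h => ((hmem σ p).1 hp).1 h.symm

lemma qdet_eq_sum {M : Matrix (Fin n) (Fin n) ℍ} (hM : Mᴴ = M) :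
    qdet M = ((∑ σ : Equiv.Perm (Fin n), (Equiv.Perm.sign σ : ℤ) •
      ∏ l ∈ Finset.univ.filter (fun l => IsCycleMin σ l), (cycProd M σ l).re : ℝ) : ℍ) := by
  have h := sum_list_prod_eq_sum_re hM (fun _ => 1)
    (fun σ => (Finset.univ.filter fun j => ∀ t, σ.SameCycle j t → j ≤ t).sort (· ≤ ·))
    (fun σ => Finset.sort_nodup _ _) (fun σ x hx y hy h => by
      simp only [Finset.mem_sort, Finset.mem_filter, Finset.mem_univ, true_and] at hx hy
      exact IsCycleMin.eq hx hy h) (fun σ p _ => by simp only [sameCycle_invertCycle])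
    (fun _ _ _ => rfl)
  simp only [one_mul] at h
  rw [qdet, h]
  simp only [list_sort_map_coe_prod]
  rw [quaternion_coe_eq_algebraMap, map_sum]
  refine Finset.sum_congr rfl fun σ _ => ?_
  rw [map_zsmul, ← quaternion_coe_eq_algebraMap]
  have e : Finset.univ.filter (fun l => IsCycleMin σ l) =
      Finset.univ.filter fun l => ∀ t, σ.SameCycle l t → l ≤ t := by
    ext l; simp only [Finset.mem_filter]; rfl
  rw [e]

end RealParts


section PrincipalMinors

variable {n : ℕ}

/-- The permutations that move only elements of `α`. -/
def permsOn (α : Finset (Fin n)) : Finset (Equiv.Perm (Fin n)) :=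
  Finset.univ.filter fun σ => ∀ a, a ∉ α → σ a = a

lemma mem_permsOn {α : Finset (Fin n)} {σ : Equiv.Perm (Fin n)} :
    σ ∈ permsOn α ↔ ∀ a, a ∉ α → σ a = a := by
  rw [permsOn, Finset.mem_filter]
  exact and_iff_right (Finset.mem_univ _)

/-- The product of the real parts of the cycles of `σ` inside `α` that avoid `j`. -/
def restProd (M : Matrix (Fin n) (Fin n) ℍ) (σ : Equiv.Perm (Fin n)) (α : Finset (Fin n))
    (j : Fin n) : ℝ :=
  ∏ l ∈ α.filter (fun l => ¬ σ.SameCycle j l ∧ IsCycleMin σ l), (cycProd M σ l).re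

/-- The `j`-th row determinant of the principal submatrix on `α` of the matrix `M` with its
`j`-th row replaced by `v`, as a sum over permutations of the whole index set. -/
def principalRdet (M : Matrix (Fin n) (Fin n) ℍ) (v : Fin n → ℍ) (α : Finset (Fin n))
    (j : Fin n) : ℍ :=
  ∑ σ ∈ permsOn α, (Equiv.Perm.sign σ : ℤ) •
    (cycProd (M.updateRow j v) σ j * ((restProd M σ α j : ℝ) : ℍ))

/-- The principal minor of `M` on `α`, as a real sum over permutations of the whole index set. -/
def principalDet (M : Matrix (Fin n) (Fin n) ℍ) (α : Finset (Fin n)) : ℝ :=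
  ∑ σ ∈ permsOn α, (Equiv.Perm.sign σ : ℤ) •
    ∏ l ∈ α.filter (fun l => IsCycleMin σ l), (cycProd M σ l).re

section Transfer

variable (α : Finset (Fin n))

/-- The extension by the identity of a permutation of the positions in `α`. -/
def extendPerm (σ : Equiv.Perm (Fin α.card)) : Equiv.Perm (Fin n) :=
  σ.extendDomain (p := fun a => a ∈ α) (α.orderIsoOfFin rfl).toEquiv

lemma extendPerm_pow_apply (σ : Equiv.Perm (Fin α.card)) (t : ℕ) (a : Fin α.card) :
    (extendPerm α σ ^ t) (α.orderIsoOfFin rfl a) = α.orderIsoOfFin rfl ((σ ^ t) a) := by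
  induction t with
  | zero => rfl
  | succ t ih =>
    rw [pow_succ', pow_succ', Equiv.Perm.mul_apply, Equiv.Perm.mul_apply, ih]
    exact Equiv.Perm.extendDomain_apply_image σ (p := fun a => a ∈ α)
      (α.orderIsoOfFin rfl).toEquiv _

lemma extendPerm_apply_of_notMem (σ : Equiv.Perm (Fin α.card)) {a : Fin n} (ha : a ∉ α) :
    extendPerm α σ a = a :=
  Equiv.Perm.extendDomain_apply_not_subtype _ _ ha

lemma sameCycle_extendPerm (σ : Equiv.Perm (Fin α.card)) (a b : Fin α.card) :
    (extendPerm α σ).SameCycle (α.orderIsoOfFin rfl a) (α.orderIsoOfFin rfl b) ↔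
      σ.SameCycle a b := by
  simp only [sameCycle_iff_exists_nat_pow, extendPerm_pow_apply, SetLike.coe_eq_coe,
    (α.orderIsoOfFin rfl).injective.eq_iff]

lemma cycProd_pSub (M : Matrix (Fin n) (Fin n) ℍ) (σ : Equiv.Perm (Fin α.card))
    (a : Fin α.card) :
    cycProd (pSub M α) σ a = cycProd M (extendPerm α σ) (α.orderIsoOfFin rfl a) := by
  have hp : Function.minimalPeriod (⇑(extendPerm α σ)) (α.orderIsoOfFin rfl a : Fin n) =
      Function.minimalPeriod (⇑σ) a :=
    minimalPeriod_eq_of_pow fun t => by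
      rw [extendPerm_pow_apply, SetLike.coe_eq_coe, (α.orderIsoOfFin rfl).injective.eq_iff]
  rw [cycProd, cycProd, hp]
  refine congrArg List.prod (List.map_congr_left fun t _ => ?_)
  rw [extendPerm_pow_apply, extendPerm_pow_apply, pSub]

lemma sameCycle_extendPerm_mem (σ : Equiv.Perm (Fin n)) (hσ : σ ∈ permsOn α) {a b : Fin n}
    (ha : a ∈ α) (h : σ.SameCycle a b) : b ∈ α := by
  by_contra hb
  have := h.eq_of_right (mem_permsOn.1 hσ b hb)
  exact hb (this ▸ ha)

lemma extendPerm_mem_permsOn (σ : Equiv.Perm (Fin α.card)) : extendPerm α σ ∈ permsOn α :=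
  mem_permsOn.2 fun _ ha => extendPerm_apply_of_notMem α σ ha

lemma isCycleMin_extendPerm (σ : Equiv.Perm (Fin α.card)) (a : Fin α.card) :
    IsCycleMin (extendPerm α σ) (α.orderIsoOfFin rfl a) ↔ IsCycleMin σ a := by
  constructor
  · intro h t ht
    have := h _ ((sameCycle_extendPerm α σ a t).2 ht)
    rwa [Subtype.coe_le_coe, OrderIso.le_iff_le] at this
  · intro h t ht
    have htα := sameCycle_extendPerm_mem α _ (extendPerm_mem_permsOn α σ)
      (α.orderIsoOfFin rfl a).2 ht
    obtain ⟨u, hu⟩ := (α.orderIsoOfFin rfl).surjective ⟨t, htα⟩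
    have hu' : t = (α.orderIsoOfFin rfl u : Fin n) := by rw [hu]
    subst hu'
    rw [Subtype.coe_le_coe, OrderIso.le_iff_le]
    exact h u ((sameCycle_extendPerm α σ a u).1 ht)

lemma sum_extendPerm {β : Type*} [AddCommMonoid β] (F : Equiv.Perm (Fin n) → β) :
    ∑ σ, F (extendPerm α σ) = ∑ σ ∈ permsOn α, F σ := by
  refine Finset.sum_nbij (extendPerm α) (fun σ _ => extendPerm_mem_permsOn α σ) ?_ ?_
    (fun _ _ => rfl)
  · intro σ _ τ _ h
    exact Equiv.Perm.extendDomainHom_injective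
      (p := fun a => a ∈ α) (α.orderIsoOfFin rfl).toEquiv h
  · intro σ hσ
    have hσ' := mem_permsOn.1 hσ
    have hp : ∀ x, σ x ∈ α ↔ x ∈ α := fun x => by
      constructor
      · intro h
        by_contra hx
        exact hx (hσ' x hx ▸ h)
      · intro h
        by_contra hx
        exact hx ((σ.injective (hσ' _ hx)).symm ▸ h)
    refine ⟨(α.orderIsoOfFin rfl).toEquiv.symm.permCongr (σ.subtypePerm hp), by simp, ?_⟩
    ext1 x
    by_cases hx : x ∈ α
    · rw [extendPerm, Equiv.Perm.extendDomain_apply_subtype _ _ hx]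
      simp
    · rw [extendPerm_apply_of_notMem α _ hx, hσ' x hx]

lemma prod_filter_orderIsoOfFin (p : Fin n → Prop) (q : Fin α.card → Prop)
    [DecidablePred p] [DecidablePred q]
    (hpq : ∀ a, p (α.orderIsoOfFin rfl a) ↔ q a) (f : Fin n → ℝ) :
    ∏ a ∈ Finset.univ.filter q, f (α.orderIsoOfFin rfl a) = ∏ l ∈ α.filter p, f l := by
  refine Finset.prod_nbij (fun a => (α.orderIsoOfFin rfl a : Fin n)) ?_ ?_ ?_ (fun _ _ => rfl)
  · intro a ha
    rw [Finset.mem_filter] at ha ⊢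
    exact ⟨(α.orderIsoOfFin rfl a).2, (hpq a).2 ha.2⟩
  · intro a _ b _ h
    exact (α.orderIsoOfFin rfl).injective (Subtype.ext h)
  · intro l hl
    have hl' := Finset.mem_filter.1 (Finset.mem_coe.1 hl)
    obtain ⟨u, hu⟩ := (α.orderIsoOfFin rfl).surjective ⟨l, hl'.1⟩
    have hu' : (α.orderIsoOfFin rfl u : Fin n) = l := by rw [hu]
    refine ⟨u, ?_, hu'⟩
    rw [Finset.mem_coe, Finset.mem_filter]
    exact ⟨Finset.mem_univ _, (hpq u).1 (hu'.symm ▸ hl'.2)⟩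

lemma sign_extendPerm (σ : Equiv.Perm (Fin α.card)) :
    Equiv.Perm.sign (extendPerm α σ) = Equiv.Perm.sign σ :=
  Equiv.Perm.sign_extendDomain σ (p := fun a => a ∈ α) (α.orderIsoOfFin rfl).toEquiv

lemma conjTranspose_pSub {M : Matrix (Fin n) (Fin n) ℍ} (hM : Mᴴ = M) :
    (pSub M α)ᴴ = pSub M α := by
  ext1 a b
  exact congrFun (congrFun hM _) _

lemma minorRdet_updateRow_eq {M : Matrix (Fin n) (Fin n) ℍ} (hM : Mᴴ = M) (v : Fin n → ℍ)
    {j : Fin n} (hj : j ∈ α) :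
    minorRdet (M.updateRow j v) α j = principalRdet M v α j := by
  obtain ⟨a, ha⟩ := (α.orderIsoOfFin rfl).surjective ⟨j, hj⟩
  have ha' : (α.orderIsoOfFin rfl a : Fin n) = j := by rw [ha]
  have hsub : pSub (M.updateRow j v) α =
      (pSub M α).updateRow a fun c => v (α.orderIsoOfFin rfl c) := by
    ext1 b c
    by_cases hb : b = a
    · subst hb
      rw [Matrix.updateRow_self, pSub, ha', Matrix.updateRow_self]
    · rw [Matrix.updateRow_ne hb, pSub, Matrix.updateRow_ne, pSub]
      rw [← ha', Ne, SetLike.coe_eq_coe, (α.orderIsoOfFin rfl).injective.eq_iff]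
      exact hb
  rw [minorRdet, dif_pos hj, ← ha, OrderIso.symm_apply_apply, hsub,
    rdet_updateRow_eq_sum (conjTranspose_pSub α hM), principalRdet, ← sum_extendPerm]
  refine Finset.sum_congr rfl fun σ _ => ?_
  rw [sign_extendPerm, ← hsub, cycProd_pSub, ha', restProd,
    ← prod_filter_orderIsoOfFin α _ (fun l => ¬ σ.SameCycle a l ∧ IsCycleMin σ l)]
  · simp only [cycProd_pSub]
  · intro b
    rw [← ha', sameCycle_extendPerm, isCycleMin_extendPerm]

lemma minorDet_eq {M : Matrix (Fin n) (Fin n) ℍ} (hM : Mᴴ = M) :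
    minorDet M α = ((principalDet M α : ℝ) : ℍ) := by
  rw [minorDet, qdet_eq_sum (conjTranspose_pSub α hM), principalDet, ← sum_extendPerm]
  congr 1
  refine Finset.sum_congr rfl fun σ _ => ?_
  rw [sign_extendPerm, ← prod_filter_orderIsoOfFin α _ (fun l => IsCycleMin σ l)]
  · simp only [cycProd_pSub]
  · exact isCycleMin_extendPerm α σ

end Transfer

section RowIdentities

variable {α : Finset (Fin n)} {j s : Fin n}

lemma cycProd_updateRow (M : Matrix (Fin n) (Fin n) ℍ) (v : Fin n → ℍ)
    (σ : Equiv.Perm (Fin n)) :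
    cycProd (M.updateRow j v) σ j = v (σ j) * cycProd (M.updateRow j 1) σ j := by
  obtain ⟨L, hL⟩ := Nat.exists_eq_succ_of_ne_zero (minimalPeriod_perm_pos σ j).ne'
  rw [cycProd, cycProd, hL, Nat.succ_eq_add_one, List.range_succ_eq_map, List.map_cons,
    List.prod_cons, List.map_cons, List.prod_cons]
  simp only [pow_zero, Equiv.Perm.one_apply, zero_add, pow_one, Matrix.updateRow_self,
    Pi.one_apply, one_mul, List.map_map]
  congr 2
  refine List.map_congr_left fun t ht => ?_
  have ht' := List.mem_range.1 ht
  have hne := pow_apply_ne_of_lt_minimalPeriod σ j t.succ_ne_zero (by omega)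
  rw [Function.comp_apply, Function.comp_apply, Matrix.updateRow_ne hne, Matrix.updateRow_ne hne]

lemma cycProd_of_fixed (A : Matrix (Fin n) (Fin n) ℍ) {σ : Equiv.Perm (Fin n)}
    (h : σ j = j) : cycProd A σ j = A j j := by
  have hp : Function.minimalPeriod (⇑σ) j = 1 :=
    Function.minimalPeriod_eq_one_iff_isFixedPt.2 h
  simp [cycProd, hp, h]

lemma principalRdet_eq_sum (M : Matrix (Fin n) (Fin n) ℍ) (v : Fin n → ℍ) :
    principalRdet M v α j = ∑ t, v t * principalRdet M (Pi.single t 1) α j := by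
  simp only [principalRdet, Finset.mul_sum]
  rw [Finset.sum_comm]
  refine Finset.sum_congr rfl fun σ _ => ?_
  rw [Finset.sum_eq_single (σ j)]
  · rw [cycProd_updateRow M v, cycProd_updateRow M (Pi.single _ _), Pi.single_eq_same, one_mul,
      mul_smul_comm, mul_assoc]
  · intro t _ ht
    rw [cycProd_updateRow, Pi.single_eq_of_ne ht.symm, zero_mul, zero_mul, smul_zero, mul_zero]
  · simp

lemma invertCycle_mem_permsOn (p : Fin n) {σ : Equiv.Perm (Fin n)} (hσ : σ ∈ permsOn α) :
    invertCycle p σ ∈ permsOn α := by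
  rw [mem_permsOn] at hσ ⊢
  intro a ha
  by_cases h : σ.SameCycle p a
  · rw [invertCycle_apply_of_sameCycle h, Equiv.Perm.inv_eq_iff_eq, hσ a ha]
  · rw [invertCycle_apply_of_not_sameCycle h, hσ a ha]

lemma sum_cycProd_mul_eq_sum_re {M : Matrix (Fin n) (Fin n) ℍ} (hM : Mᴴ = M) (p : Fin n)
    (P : Finset (Equiv.Perm (Fin n))) (hP : ∀ σ ∈ P, invertCycle p σ ∈ P)
    (g : Equiv.Perm (Fin n) → ℍ) (hg : ∀ σ ∈ P, g (invertCycle p σ) = g σ) :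
    ∑ σ ∈ P, (Equiv.Perm.sign σ : ℤ) • (cycProd M σ p * g σ) =
      ∑ σ ∈ P, (Equiv.Perm.sign σ : ℤ) • ((((cycProd M σ p).re : ℝ) : ℍ) * g σ) := by
  refine sum_sign_smul_eq_of_involution (invertCycle p) (invertCycle_invertCycle p) hP
    (sign_invertCycle p) _ _ fun σ hσ => ?_
  rw [hg σ hσ, cycProd_invertCycle_of_sameCycle hM (Equiv.Perm.SameCycle.refl σ p), ← add_mul,
    add_star_eq_two_nsmul_re, smul_mul_assoc]

lemma exists_isCycleMin {σ : Equiv.Perm (Fin n)} (s : Fin n) :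
    ∃ l, σ.SameCycle s l ∧ IsCycleMin σ l := by
  obtain ⟨l, hl, hmin⟩ := Finset.exists_min_image (Finset.univ.filter fun x => σ.SameCycle s x) id
    ⟨s, by simpa using Equiv.Perm.SameCycle.refl σ s⟩
  simp only [Finset.mem_filter, Finset.mem_univ, true_and, id] at hl hmin
  exact ⟨l, hl, fun t ht => hmin t (hl.trans ht)⟩

lemma prod_cycles_eq_mul (M : Matrix (Fin n) (Fin n) ℍ) {σ : Equiv.Perm (Fin n)}
    (hσ : σ ∈ permsOn α) (hs : s ∈ α) (Q : Fin n → Prop) [DecidablePred Q]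
    (hQ : ∀ x, σ.SameCycle s x → Q x) :
    ∏ l ∈ α.filter (fun l => Q l ∧ IsCycleMin σ l), (cycProd M σ l).re =
      (cycProd M σ s).re *
        ∏ l ∈ α.filter (fun l => Q l ∧ ¬ σ.SameCycle s l ∧ IsCycleMin σ l),
          (cycProd M σ l).re := by
  obtain ⟨l₀, hl, hmin⟩ := exists_isCycleMin (σ := σ) s
  have hset : α.filter (fun l => Q l ∧ IsCycleMin σ l) =
      insert l₀ (α.filter fun l => Q l ∧ ¬ σ.SameCycle s l ∧ IsCycleMin σ l) := by
    ext x
    simp only [Finset.mem_insert, Finset.mem_filter]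
    constructor
    · rintro ⟨hx, hq, hm⟩
      by_cases h : σ.SameCycle s x
      · exact Or.inl (hm.eq hmin (h.symm.trans hl))
      · exact Or.inr ⟨hx, hq, h, hm⟩
    · rintro (rfl | ⟨hx, hq, -, hm⟩)
      · exact ⟨sameCycle_extendPerm_mem α σ hσ hs hl, hQ _ hl, hmin⟩
      · exact ⟨hx, hq, hm⟩
  rw [hset, Finset.prod_insert, re_cycProd_eq_of_sameCycle M hl]
  simp [hl]

lemma restProd_invertCycle {M : Matrix (Fin n) (Fin n) ℍ} (hM : Mᴴ = M) (p : Fin n)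
    (σ : Equiv.Perm (Fin n)) : restProd M (invertCycle p σ) α j = restProd M σ α j := by
  rw [restProd, restProd]
  refine Finset.prod_congr ?_ fun l _ => re_cycProd_invertCycle hM p l σ
  ext l
  simp only [Finset.mem_filter, sameCycle_invertCycle, isCycleMin_invertCycle]

lemma principalRdet_row_self {M : Matrix (Fin n) (Fin n) ℍ} (hM : Mᴴ = M) (hj : j ∈ α) :
    principalRdet M (M j) α j = ((principalDet M α : ℝ) : ℍ) := by
  rw [principalRdet, Matrix.updateRow_eq_self, sum_cycProd_mul_eq_sum_re hM j (permsOn α)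
    (fun σ hσ => invertCycle_mem_permsOn j hσ) _
    (fun σ _ => by rw [restProd_invertCycle hM]), principalDet, quaternion_coe_eq_algebraMap,
    map_sum]
  refine Finset.sum_congr rfl fun σ hσ => ?_
  have h := prod_cycles_eq_mul M hσ hj (fun _ => True) (fun _ _ => trivial)
  simp only [true_and] at h
  rw [h, map_zsmul, map_mul]
  rfl

lemma isCycleMin_mul_swap {σ : Equiv.Perm (Fin n)} {l : Fin n} (hj : ¬ σ.SameCycle j l)
    (hs : ¬ σ.SameCycle s l) : IsCycleMin (σ * Equiv.swap j s) l ↔ IsCycleMin σ l := by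
  simp only [IsCycleMin, sameCycle_mul_swap_of_not_sameCycle hj hs]

lemma restProd_mul_swap (M : Matrix (Fin n) (Fin n) ℍ) {σ : Equiv.Perm (Fin n)}
    (h : ¬ σ.SameCycle j s) :
    restProd M (σ * Equiv.swap j s) α j =
      ∏ l ∈ α.filter (fun l => ¬ σ.SameCycle j l ∧ ¬ σ.SameCycle s l ∧ IsCycleMin σ l),
        (cycProd M σ l).re := by
  have hset : α.filter (fun l => ¬ (σ * Equiv.swap j s).SameCycle j l ∧
      IsCycleMin (σ * Equiv.swap j s) l) =
      α.filter (fun l => ¬ σ.SameCycle j l ∧ ¬ σ.SameCycle s l ∧ IsCycleMin σ l) := by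
    ext l
    simp only [Finset.mem_filter, sameCycle_mul_swap_iff h, not_or]
    constructor
    · rintro ⟨hl, ⟨h1, h2⟩, h3⟩
      exact ⟨hl, h1, h2, (isCycleMin_mul_swap h1 h2).1 h3⟩
    · rintro ⟨hl, h1, h2, h3⟩
      exact ⟨hl, ⟨h1, h2⟩, (isCycleMin_mul_swap h1 h2).2 h3⟩
  rw [restProd, hset]
  refine Finset.prod_congr rfl fun l hl => ?_
  rw [Finset.mem_filter] at hl
  rw [cycProd_mul_swap_of_not_sameCycle M hl.2.1 hl.2.2.1]

lemma mul_swap_mem_permsOn {σ : Equiv.Perm (Fin n)} (hσ : σ ∈ permsOn α) (hj : j ∈ α)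
    (hs : s ∈ α) : σ * Equiv.swap j s ∈ permsOn α := by
  rw [mem_permsOn] at hσ ⊢
  intro a ha
  rw [Equiv.Perm.mul_apply, Equiv.swap_apply_of_ne_of_ne (fun e => ha (by rwa [e]))
    (fun e => ha (by rwa [e])), hσ a ha]

lemma mul_swap_mul_swap (σ : Equiv.Perm (Fin n)) :
    σ * Equiv.swap j s * Equiv.swap j s = σ := by
  rw [mul_assoc, Equiv.swap_mul_self, mul_one]

lemma principalRdet_row_of_mem {M : Matrix (Fin n) (Fin n) ℍ} (hM : Mᴴ = M) (hj : j ∈ α)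
    (hs : s ∈ α) (hne : j ≠ s) : principalRdet M (M s) α j = 0 := by
  rw [principalRdet, ← Finset.sum_filter_add_sum_filter_not _ fun σ => σ.SameCycle j s]
  have h1 : ∑ σ ∈ (permsOn α).filter (fun σ => σ.SameCycle j s), (Equiv.Perm.sign σ : ℤ) •
      (cycProd (M.updateRow j (M s)) σ j * ((restProd M σ α j : ℝ) : ℍ)) =
      ∑ σ ∈ (permsOn α).filter (fun σ => ¬ σ.SameCycle j s), (Equiv.Perm.sign σ : ℤ) •
      (cycProd M σ s * (-(cycProd (M.updateRow j (M s)) σ j *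
        ((∏ l ∈ α.filter (fun l => ¬ σ.SameCycle j l ∧ ¬ σ.SameCycle s l ∧ IsCycleMin σ l),
        (cycProd M σ l).re : ℝ) : ℍ)))) := by
    refine Finset.sum_nbij' (fun σ => σ * Equiv.swap j s) (fun σ => σ * Equiv.swap j s)
      ?_ ?_ (fun σ _ => mul_swap_mul_swap σ) (fun σ _ => mul_swap_mul_swap σ) ?_
    · intro σ hσ
      rw [Finset.mem_filter] at hσ ⊢
      exact ⟨mul_swap_mem_permsOn hσ.1 hj hs, not_sameCycle_mul_swap hne hσ.2⟩
    · intro σ hσ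
      rw [Finset.mem_filter] at hσ ⊢
      exact ⟨mul_swap_mem_permsOn hσ.1 hj hs, sameCycle_mul_swap hσ.2⟩
    · intro σ hσ
      rw [Finset.mem_filter] at hσ
      have hA := not_sameCycle_mul_swap hne hσ.2
      conv_lhs => rw [← mul_swap_mul_swap (j := j) (s := s) σ]
      generalize σ * Equiv.swap j s = τ at hA
      rw [cycProd_mul_swap M _ hA, Matrix.updateRow_eq_self, restProd_mul_swap M hA,
        sign_mul_swap hne, mul_neg, smul_neg, Units.val_neg, neg_smul, mul_assoc]
  rw [h1, sum_cycProd_mul_eq_sum_re hM s, ← Finset.sum_add_distrib]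
  · refine Finset.sum_eq_zero fun σ hσ => ?_
    rw [Finset.mem_filter] at hσ
    have h2 := prod_cycles_eq_mul M hσ.1 hs (fun l => ¬ σ.SameCycle j l)
      (fun x hx h => hσ.2 (h.trans hx.symm))
    rw [restProd, h2, ← smul_add, Quaternion.coe_mul, mul_neg, ← mul_assoc, ← mul_assoc,
      Quaternion.coe_commutes, neg_add_cancel, smul_zero]
  · intro σ hσ
    rw [Finset.mem_filter] at hσ ⊢
    exact ⟨invertCycle_mem_permsOn s hσ.1, fun h => hσ.2 ((sameCycle_invertCycle s σ j s).1 h)⟩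
  · intro σ hσ
    rw [Finset.mem_filter] at hσ
    have hns : ¬ σ.SameCycle s j := fun h => hσ.2 h.symm
    rw [cycProd_invertCycle_of_not_sameCycle _ hns]
    simp only [re_cycProd_invertCycle hM, sameCycle_invertCycle, isCycleMin_invertCycle]

lemma principalRdet_single_insert (M : Matrix (Fin n) (Fin n) ℍ) (hj : j ∈ α) (hs : s ∉ α) :
    principalRdet M (Pi.single s 1) (insert s α) j = -principalRdet M (M s) α j := by
  have hne : j ≠ s := fun e => hs (e ▸ hj)
  have hfix : ∀ σ ∈ permsOn α, σ s = s := fun σ hσ => mem_permsOn.1 hσ s hs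
  have hns : ∀ σ ∈ permsOn α, ¬ σ.SameCycle j s := fun σ hσ h =>
    hne (h.eq_of_right (hfix σ hσ))
  rw [principalRdet, principalRdet, ← Finset.sum_neg_distrib,
    ← Finset.sum_filter_of_ne (p := fun σ => σ j = s)]
  · symm
    refine Finset.sum_nbij' (fun σ => σ * Equiv.swap j s) (fun σ => σ * Equiv.swap j s)
      ?_ ?_ (fun σ _ => mul_swap_mul_swap σ) (fun σ _ => mul_swap_mul_swap σ) ?_
    · intro σ hσ
      rw [Finset.mem_filter]
      refine ⟨mul_swap_mem_permsOn (mem_permsOn.2 fun a ha => mem_permsOn.1 hσ a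
        fun h => ha (Finset.mem_insert_of_mem h)) (Finset.mem_insert_of_mem hj)
        (Finset.mem_insert_self _ _), ?_⟩
      rw [Equiv.Perm.mul_apply, Equiv.swap_apply_left, hfix σ hσ]
    · intro σ hσ
      rw [Finset.mem_filter] at hσ
      rw [mem_permsOn]
      intro a ha
      by_cases has : a = s
      · rw [has, Equiv.Perm.mul_apply, Equiv.swap_apply_right, hσ.2]
      · exact mem_permsOn.1 (mul_swap_mem_permsOn hσ.1 (Finset.mem_insert_of_mem hj)
          (Finset.mem_insert_self s α)) a (by simp [has, ha])
    · intro σ hσ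
      have h := hns σ hσ
      rw [cycProd_mul_swap M _ h, cycProd_of_fixed _ (hfix σ hσ), Matrix.updateRow_self,
        Pi.single_eq_same, one_mul, restProd_mul_swap M h, sign_mul_swap hne, Units.val_neg,
        neg_smul, restProd]
      congr 5
      ext l
      simp only [Finset.mem_filter, Finset.mem_insert]
      have hsl : ∀ x, σ.SameCycle s x → s = x := fun x hx => hx.eq_of_left (hfix σ hσ)
      constructor
      · rintro ⟨hl, h1, h2⟩
        exact ⟨Or.inr hl, h1, fun h3 => hs (hsl l h3 ▸ hl), h2⟩
      · rintro ⟨rfl | hl, h1, h3, h2⟩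
        · exact absurd (Equiv.Perm.SameCycle.refl σ l) h3
        · exact ⟨hl, h1, h2⟩
  · intro σ _ h
    by_contra hc
    rw [cycProd_updateRow, Pi.single_eq_of_ne hc, zero_mul, zero_mul, smul_zero] at h
    exact h rfl

lemma principalRdet_single_self (M : Matrix (Fin n) (Fin n) ℍ) :
    principalRdet M (Pi.single j 1) α j = ((principalDet M (α.erase j) : ℝ) : ℍ) := by
  rw [principalRdet, principalDet, quaternion_coe_eq_algebraMap, map_sum,
    ← Finset.sum_filter_of_ne (p := fun σ => σ j = j)]
  · have hset : (permsOn α).filter (fun σ => σ j = j) = permsOn (α.erase j) := by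
      ext σ
      rw [Finset.mem_filter, mem_permsOn, mem_permsOn]
      constructor
      · rintro ⟨h1, h2⟩ a ha
        by_cases e : a = j
        · rw [e, h2]
        · exact h1 a fun h => ha (Finset.mem_erase.2 ⟨e, h⟩)
      · intro h
        exact ⟨fun a ha => h a fun h' => ha (Finset.mem_of_mem_erase h'),
          h j (Finset.notMem_erase j α)⟩
    rw [hset]
    refine Finset.sum_congr rfl fun σ hσ => ?_
    have hfix : σ j = j := mem_permsOn.1 hσ j (Finset.notMem_erase j α)
    rw [cycProd_of_fixed _ hfix, Matrix.updateRow_self, Pi.single_eq_same, one_mul, map_zsmul,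
      restProd, quaternion_coe_eq_algebraMap]
    congr 3
    ext l
    simp only [Finset.mem_filter, Finset.mem_erase]
    constructor
    · rintro ⟨hl, h1, h2⟩
      exact ⟨⟨(ne_of_not_sameCycle h1).symm, hl⟩, h2⟩
    · rintro ⟨⟨hne, hl⟩, h2⟩
      exact ⟨hl, fun h => hne (h.eq_of_left hfix).symm, h2⟩
  · intro σ _ h
    by_contra hc
    rw [cycProd_updateRow, Pi.single_eq_of_ne hc, zero_mul, zero_mul, smul_zero] at h
    exact h rfl

lemma principalRdet_single_of_notMem (M : Matrix (Fin n) (Fin n) ℍ) (hj : j ∈ α)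
    (hs : s ∉ α) : principalRdet M (Pi.single s 1) α j = 0 := by
  refine Finset.sum_eq_zero fun σ hσ => ?_
  have hne : σ j ≠ s := fun e => hs (e ▸ sameCycle_extendPerm_mem α σ hσ hj
    (Equiv.Perm.sameCycle_apply_right.2 (Equiv.Perm.SameCycle.refl σ j)))
  rw [cycProd_updateRow, Pi.single_eq_of_ne hne, zero_mul, zero_mul, smul_zero]

end RowIdentities

end PrincipalMinors


section CharacteristicCoefficients

variable {n : ℕ}

/-- The sum of the principal minors of order `k`. -/
def minorSum (M : Matrix (Fin n) (Fin n) ℍ) (k : ℕ) : ℝ :=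
  ∑ α ∈ Finset.powersetCard k Finset.univ, principalDet M α

/-- The matrix whose `(s, j)` entry is the sum of the order-`k` principal row determinants
along `j` with row `j` replaced by the `s`-th unit row. -/
def coefMat (M : Matrix (Fin n) (Fin n) ℍ) (k : ℕ) : Matrix (Fin n) (Fin n) ℍ :=
  fun s j => ∑ α ∈ (Finset.powersetCard k Finset.univ).filter (fun α => j ∈ α),
    principalRdet M (Pi.single s 1) α j

lemma sum_mul_coefMat (M : Matrix (Fin n) (Fin n) ℍ) (k : ℕ) (v : Fin n → ℍ) (j : Fin n) :
    ∑ s, v s * coefMat M k s j =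
      ∑ α ∈ (Finset.powersetCard k Finset.univ).filter (fun α => j ∈ α),
        principalRdet M v α j := by
  simp only [coefMat, Finset.mul_sum]
  rw [Finset.sum_comm]
  exact Finset.sum_congr rfl fun α _ => (principalRdet_eq_sum M v).symm

lemma coefMat_apply_self (M : Matrix (Fin n) (Fin n) ℍ) (k : ℕ) (j : Fin n) :
    coefMat M (k + 1) j j =
      ∑ α ∈ (Finset.powersetCard k Finset.univ).filter (fun α => j ∉ α),
        ((principalDet M α : ℝ) : ℍ) := by
  rw [coefMat]
  refine Finset.sum_bij' (fun α _ => α.erase j) (fun α _ => insert j α) ?_ ?_ ?_ ?_ ?_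
  · intro α hα
    simp only [Finset.mem_filter, Finset.mem_powersetCard_univ] at hα ⊢
    exact ⟨by rw [Finset.card_erase_of_mem hα.2, hα.1]; rfl, Finset.notMem_erase j α⟩
  · intro α hα
    simp only [Finset.mem_filter, Finset.mem_powersetCard_univ] at hα ⊢
    exact ⟨by rw [Finset.card_insert_of_notMem hα.2, hα.1], Finset.mem_insert_self j α⟩
  · intro α hα
    exact Finset.insert_erase (Finset.mem_filter.1 hα).2
  · intro α hα
    exact Finset.erase_insert (Finset.mem_filter.1 hα).2
  · intro α _
    exact principalRdet_single_self M

lemma coefMat_apply_of_ne {M : Matrix (Fin n) (Fin n) ℍ} (hM : Mᴴ = M) (k : ℕ) {s j : Fin n}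
    (hne : j ≠ s) : coefMat M (k + 1) s j = -(M * coefMat M k) s j := by
  rw [Matrix.mul_apply, sum_mul_coefMat M k (M s) j, coefMat, ← Finset.sum_neg_distrib,
    ← Finset.sum_filter_add_sum_filter_not _ (fun α => s ∈ α),
    ← Finset.sum_filter_add_sum_filter_not
      ((Finset.powersetCard k Finset.univ).filter (fun α => j ∈ α)) (fun α => s ∈ α)]
  have h₁ : ∑ α ∈ ((Finset.powersetCard (k + 1) Finset.univ).filter (fun α => j ∈ α)).filter
      (fun α => s ∉ α), principalRdet M (Pi.single s 1) α j = 0 := by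
    refine Finset.sum_eq_zero fun α hα => ?_
    simp only [Finset.mem_filter] at hα
    exact principalRdet_single_of_notMem M hα.1.2 hα.2
  have h₂ : ∑ α ∈ ((Finset.powersetCard k Finset.univ).filter (fun α => j ∈ α)).filter
      (fun α => s ∈ α), -principalRdet M (M s) α j = 0 := by
    refine Finset.sum_eq_zero fun α hα => ?_
    simp only [Finset.mem_filter] at hα
    rw [principalRdet_row_of_mem hM hα.1.2 hα.2 hne, neg_zero]
  rw [h₁, h₂, add_zero, zero_add]
  refine Finset.sum_bij' (fun α _ => α.erase s) (fun α _ => insert s α) ?_ ?_ ?_ ?_ ?_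
  · intro α hα
    simp only [Finset.mem_filter, Finset.mem_powersetCard_univ] at hα ⊢
    exact ⟨⟨by rw [Finset.card_erase_of_mem hα.2, hα.1.1]; rfl,
      Finset.mem_erase.2 ⟨hne, hα.1.2⟩⟩, Finset.notMem_erase s α⟩
  · intro α hα
    simp only [Finset.mem_filter, Finset.mem_powersetCard_univ] at hα ⊢
    exact ⟨⟨by rw [Finset.card_insert_of_notMem hα.2, hα.1.1],
      Finset.mem_insert_of_mem hα.1.2⟩, Finset.mem_insert_self s α⟩
  · intro α hα
    exact Finset.insert_erase (Finset.mem_filter.1 hα).2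
  · intro α hα
    exact Finset.erase_insert (Finset.mem_filter.1 hα).2
  · intro α hα
    simp only [Finset.mem_filter] at hα
    rw [← principalRdet_single_insert M (Finset.mem_erase.2 ⟨hne, hα.1.2⟩)
      (Finset.notMem_erase s α), Finset.insert_erase hα.2]

lemma mul_coefMat_add_coefMat {M : Matrix (Fin n) (Fin n) ℍ} (hM : Mᴴ = M) (k : ℕ) :
    M * coefMat M k + coefMat M (k + 1) = minorSum M k • (1 : Matrix (Fin n) (Fin n) ℍ) := by
  ext1 s j
  rw [Matrix.add_apply, Matrix.smul_apply]
  by_cases hne : j = s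
  · subst hne
    rw [Matrix.one_apply_eq, coefMat_apply_self, Matrix.mul_apply, sum_mul_coefMat M k (M j) j,
      ← Algebra.algebraMap_eq_smul_one, minorSum, map_sum,
      ← Finset.sum_filter_add_sum_filter_not (Finset.powersetCard k Finset.univ) (fun α => j ∈ α)]
    congr 1
    refine Finset.sum_congr rfl fun α hα => ?_
    exact principalRdet_row_self hM (Finset.mem_filter.1 hα).2
  · rw [coefMat_apply_of_ne hM k hne, add_neg_cancel, Matrix.one_apply_ne (Ne.symm hne), smul_zero]

lemma re_trace_coefMat (M : Matrix (Fin n) (Fin n) ℍ) (k : ℕ) :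
    (coefMat M (k + 1)).trace.re = ((n : ℝ) - k) * minorSum M k := by
  have h : (coefMat M (k + 1)).trace = algebraMap ℝ ℍ (((n : ℝ) - k) * minorSum M k) := by
    rw [Matrix.trace, minorSum, Finset.mul_sum, map_sum]
    simp only [Matrix.diag_apply, coefMat_apply_self, Finset.sum_filter]
    rw [Finset.sum_comm]
    refine Finset.sum_congr rfl fun α hα => ?_
    rw [← Finset.sum_filter, Finset.sum_const, quaternion_coe_eq_algebraMap, ← map_nsmul,
      nsmul_eq_mul]
    congr 2
    rw [Finset.mem_powersetCard_univ] at hα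
    rw [show (Finset.univ.filter fun x => x ∉ α) = αᶜ by ext; simp, Finset.card_compl, hα,
      Fintype.card_fin, Nat.cast_sub]
    simpa [hα] using Finset.card_le_univ α
  rw [h]
  rfl

lemma coefMat_zero (M : Matrix (Fin n) (Fin n) ℍ) : coefMat M 0 = 0 := by
  ext1 s j
  rw [coefMat, Finset.powersetCard_zero, Finset.filter_singleton, if_neg (Finset.notMem_empty j)]
  rfl

lemma coefMat_of_lt (M : Matrix (Fin n) (Fin n) ℍ) {k : ℕ} (hk : n < k) : coefMat M k = 0 := by
  ext1 s j
  rw [coefMat, Finset.powersetCard_eq_empty.2 (by simpa using hk)]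
  simp

lemma minorSum_of_lt (M : Matrix (Fin n) (Fin n) ℍ) {k : ℕ} (hk : n < k) : minorSum M k = 0 := by
  rw [minorSum, Finset.powersetCard_eq_empty.2 (by simpa using hk), Finset.sum_empty]

lemma minorSum_zero (M : Matrix (Fin n) (Fin n) ℍ) : minorSum M 0 = 1 := by
  have h : permsOn (∅ : Finset (Fin n)) = {1} := by
    ext σ
    simp [mem_permsOn, Equiv.ext_iff]
  simp [minorSum, principalDet, h]

lemma commute_coefMat {M : Matrix (Fin n) (Fin n) ℍ} (hM : Mᴴ = M) (k : ℕ) :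
    Commute M (coefMat M k) := by
  induction k with
  | zero => rw [coefMat_zero]; exact Commute.zero_right M
  | succ k ih =>
    rw [eq_sub_iff_add_eq'.2 (mul_coefMat_add_coefMat hM k)]
    exact ((Commute.one_right M).smul_right _).sub_right ((Commute.refl M).mul_right ih)

lemma eq_zero_of_conjTranspose_mul_self {m p : ℕ} {B : Matrix (Fin m) (Fin p) ℍ}
    (h : Bᴴ * B = 0) : B = 0 := by
  ext1 i j
  have hj : ∑ t, Quaternion.normSq (B t j) = 0 := by
    have := congrFun (congrFun h j) j
    rw [Matrix.mul_apply] at this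
    simp only [Matrix.conjTranspose_apply, Quaternion.star_mul_self, Matrix.zero_apply,
      quaternion_coe_eq_algebraMap, ← map_sum] at this
    exact (map_eq_zero_iff _ (algebraMap ℝ ℍ).injective).1 this
  rw [Finset.sum_eq_zero_iff_of_nonneg fun _ _ => Quaternion.normSq_nonneg] at hj
  exact Quaternion.normSq_eq_zero.1 (hj i (Finset.mem_univ i))

lemma mul_eq_zero_of_mul_mul_eq_zero {p : ℕ} {M : Matrix (Fin n) (Fin n) ℍ} (hM : Mᴴ = M)
    {B : Matrix (Fin n) (Fin p) ℍ} (h : M * (M * B) = 0) : M * B = 0 := by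
  refine eq_zero_of_conjTranspose_mul_self ?_
  rw [Matrix.conjTranspose_mul, hM, Matrix.mul_assoc, h, Matrix.mul_zero]

lemma mul_coefMat_eq_zero {M : Matrix (Fin n) (Fin n) ℍ} (hM : Mᴴ = M) {s : ℕ}
    (hs : ∀ k, s < k → minorSum M k = 0) {k : ℕ} (hk : s < k) : M * coefMat M k = 0 := by
  by_cases hkn : n < k
  · rw [coefMat_of_lt M hkn, Matrix.mul_zero]
  · have ih := mul_coefMat_eq_zero hM hs (k := k + 1) (by omega)
    have h := mul_coefMat_add_coefMat hM k
    rw [hs k hk, zero_smul] at h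
    refine mul_eq_zero_of_mul_mul_eq_zero hM ?_
    rw [eq_neg_of_add_eq_zero_left h, Matrix.mul_neg, ih, neg_zero]
termination_by n + 1 - k

end CharacteristicCoefficients

section Rank

variable {m n p : ℕ}

/-- The left row space of a quaternion matrix. -/
def rowSpace (A : Matrix (Fin m) (Fin n) ℍ) : Submodule ℍ (Fin n → ℍ) :=
  Submodule.span ℍ (Set.range A)

lemma qrank_eq_finrank_rowSpace (A : Matrix (Fin m) (Fin n) ℍ) :
    qrank A = Module.finrank ℍ (rowSpace A) := rfl

lemma row_mem_rowSpace (A : Matrix (Fin m) (Fin n) ℍ) (i : Fin m) : A i ∈ rowSpace A :=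
  Submodule.subset_span ⟨i, rfl⟩

lemma mul_row_eq_sum (B : Matrix (Fin m) (Fin p) ℍ) (A : Matrix (Fin p) (Fin n) ℍ) (i : Fin m) :
    (B * A) i = ∑ t, B i t • A t := by
  ext1 j
  simp [Matrix.mul_apply]

lemma rowSpace_mul_le (B : Matrix (Fin m) (Fin p) ℍ) (A : Matrix (Fin p) (Fin n) ℍ) :
    rowSpace (B * A) ≤ rowSpace A := by
  rw [rowSpace, Submodule.span_le]
  rintro _ ⟨i, rfl⟩
  rw [mul_row_eq_sum]
  exact Submodule.sum_mem _ fun t _ => Submodule.smul_mem _ _ (row_mem_rowSpace A t)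

lemma exists_eq_mul_of_rowSpace_le {B : Matrix (Fin m) (Fin n) ℍ} {A : Matrix (Fin p) (Fin n) ℍ}
    (h : rowSpace B ≤ rowSpace A) : ∃ Y : Matrix (Fin m) (Fin p) ℍ, B = Y * A := by
  have hrow : ∀ i, ∃ c : Fin p → ℍ, ∑ t, c t • A t = B i := fun i =>
    (Submodule.mem_span_range_iff_exists_fun ℍ).1 (h (row_mem_rowSpace B i))
  choose Y hY using hrow
  refine ⟨Matrix.of Y, funext fun i => ?_⟩
  rw [mul_row_eq_sum, ← hY]
  rfl

lemma re_trace_mul_comm (B : Matrix (Fin m) (Fin p) ℍ) (C : Matrix (Fin p) (Fin m) ℍ) :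
    (B * C).trace.re = (C * B).trace.re := by
  have hsum : ∀ {q : ℕ} (f : Fin q → ℍ), (∑ i, f i).re = ∑ i, (f i).re := fun f =>
    map_sum (QuaternionAlgebra.reₗ (R := ℝ) (-1) 0 (-1)) f Finset.univ
  simp only [Matrix.trace, Matrix.diag_apply, Matrix.mul_apply, hsum]
  rw [Finset.sum_comm]
  exact Finset.sum_congr rfl fun _ _ => Finset.sum_congr rfl fun _ _ => quaternion_re_mul_comm _ _

lemma re_trace_eq_qrank_of_isIdempotentElem {E : Matrix (Fin n) (Fin n) ℍ} (hE : E * E = E) :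
    E.trace.re = qrank E := by
  let b := Module.finBasis ℍ (rowSpace E)
  let C : Matrix (Fin (qrank E)) (Fin n) ℍ := fun t => (b t : Fin n → ℍ)
  let B : Matrix (Fin n) (Fin (qrank E)) ℍ := fun i => b.repr ⟨E i, row_mem_rowSpace E i⟩
  have hC : LinearIndependent ℍ C :=
    b.linearIndependent.map' (rowSpace E).subtype (Submodule.ker_subtype _)
  have hBC : E = B * C := by
    funext i
    have := congrArg (rowSpace E).subtype (b.sum_repr ⟨E i, row_mem_rowSpace E i⟩)
    rw [map_sum] at this
    simp only [map_smul] at this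
    rw [mul_row_eq_sum]
    exact this.symm
  obtain ⟨Y, hY⟩ : ∃ Y : Matrix (Fin (qrank E)) (Fin n) ℍ, C = Y * E := by
    refine exists_eq_mul_of_rowSpace_le ?_
    rw [rowSpace, Submodule.span_le]
    rintro _ ⟨t, rfl⟩
    exact (b t).2
  have hCE : C * E = C := by
    rw [hY, Matrix.mul_assoc, hE]
  have hCB : C * B = 1 := by
    ext1 s t
    have h : ∑ t, (C * B - 1 : Matrix (Fin (qrank E)) (Fin (qrank E)) ℍ) s t • C t = 0 := by
      rw [← mul_row_eq_sum, Matrix.sub_mul, Matrix.mul_assoc, ← hBC, hCE, Matrix.one_mul, sub_self]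
      rfl
    exact sub_eq_zero.1 (Fintype.linearIndependent_iff.1 hC _ h t)
  calc E.trace.re = (C * B).trace.re := by rw [← re_trace_mul_comm, ← hBC]
    _ = qrank E := by rw [hCB, Matrix.trace_one, Fintype.card_fin]; rfl

lemma minorSum_qrank_ne_zero_and_mul_coefMat_eq_zero {M : Matrix (Fin n) (Fin n) ℍ}
    (hM : Mᴴ = M) : minorSum M (qrank M) ≠ 0 ∧ M * coefMat M (qrank M + 1) = 0 := by
  let s := Nat.findGreatest (fun k => minorSum M k ≠ 0) n
  have hd : minorSum M s ≠ 0 :=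
    Nat.findGreatest_spec (P := fun k => minorSum M k ≠ 0) (Nat.zero_le n)
      (by rw [minorSum_zero]; exact one_ne_zero)
  have hs : ∀ k, s < k → minorSum M k = 0 := fun k hk => by
    by_cases hkn : k ≤ n
    · exact not_not.1 (Nat.findGreatest_is_greatest hk hkn)
    · exact minorSum_of_lt M (by omega)
  have h₀ := mul_coefMat_eq_zero hM hs (Nat.lt_succ_self s)
  have hid := mul_coefMat_add_coefMat hM s
  set d := minorSum M s with hd_def
  let E : Matrix (Fin n) (Fin n) ℍ := d⁻¹ • (M * coefMat M s)
  have hE : E = 1 - d⁻¹ • coefMat M (s + 1) := by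
    simp only [E]
    rw [eq_sub_iff_add_eq.2 hid, smul_sub, smul_smul, inv_mul_cancel₀ hd, one_smul]
  have hME : M * E = M := by
    rw [hE, Matrix.mul_sub, Matrix.mul_smul, h₀, smul_zero, sub_zero, Matrix.mul_one]
  have hEM : E = (d⁻¹ • coefMat M s) * M := by
    rw [Matrix.smul_mul, ← (commute_coefMat hM s).eq]
  have hEE : E * E = E := by
    nth_rw 1 [hEM]
    rw [Matrix.mul_assoc, hME, ← hEM]
  have hspace : rowSpace E = rowSpace M :=
    le_antisymm (hEM ▸ rowSpace_mul_le _ M) (hME ▸ rowSpace_mul_le M E)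
  have hrank : (qrank M : ℝ) = s := by
    rw [qrank_eq_finrank_rowSpace, ← hspace, ← qrank_eq_finrank_rowSpace,
      ← re_trace_eq_qrank_of_isIdempotentElem hEE, hE, Matrix.trace_sub, Matrix.trace_smul,
      Matrix.trace_one, Fintype.card_fin, Quaternion.re_sub, Quaternion.re_smul,
      re_trace_coefMat, ← hd_def, smul_eq_mul]
    field_simp
    simp
  rw [Nat.cast_injective hrank]
  exact ⟨hd, h₀⟩

lemma qrank_pow_add_two_eq {H : Matrix (Fin n) (Fin n) ℍ} {k : ℕ}
    (h : qrank (H ^ (k + 1)) = qrank (H ^ k)) : qrank (H ^ (k + 2)) = qrank (H ^ k) := by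
  have h₁ : rowSpace (H ^ (k + 1)) = rowSpace (H ^ k) :=
    Submodule.eq_of_le_of_finrank_eq (pow_succ' H k ▸ rowSpace_mul_le H (H ^ k)) h
  obtain ⟨Y, hY⟩ := exists_eq_mul_of_rowSpace_le h₁.ge
  have h₂ : rowSpace (H ^ (k + 2)) = rowSpace (H ^ (k + 1)) := by
    refine le_antisymm (pow_succ' H (k + 1) ▸ rowSpace_mul_le H (H ^ (k + 1))) ?_
    have : H ^ (k + 1) = Y * H ^ (k + 2) := by
      rw [pow_succ H (k + 1), ← Matrix.mul_assoc, ← hY, ← pow_succ]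
    exact this ▸ rowSpace_mul_le Y _
  rw [qrank_eq_finrank_rowSpace, h₂, ← qrank_eq_finrank_rowSpace, h]

end Rank

section WeightedDrazin

variable {m n : ℕ}

lemma mul_pow_mul_eq (A : Matrix (Fin m) (Fin n) ℍ) (W : Matrix (Fin n) (Fin m) ℍ) (p : ℕ) :
    (A * W) ^ p * A = A * (W * A) ^ p := by
  induction p with
  | zero => rw [pow_zero, pow_zero, Matrix.one_mul, Matrix.mul_one]
  | succ p ih =>
    rw [pow_succ', pow_succ', Matrix.mul_assoc, ih]
    simp only [Matrix.mul_assoc]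

lemma IsWDrazin.mul_pow_eq {A X : Matrix (Fin m) (Fin n) ℍ} {W : Matrix (Fin n) (Fin m) ℍ}
    (hX : IsWDrazin A W X) (p : ℕ) : X * (W * A) ^ p = (A * W) ^ p * X := by
  induction p with
  | zero => rw [pow_zero, pow_zero, Matrix.one_mul, Matrix.mul_one]
  | succ p ih =>
    rw [pow_succ, ← Matrix.mul_assoc, ih, Matrix.mul_assoc, ← Matrix.mul_assoc X, ← hX.2.2,
      pow_succ, Matrix.mul_assoc ((A * W) ^ p)]

lemma IsWDrazin.mul_pow_add_two {A X : Matrix (Fin m) (Fin n) ℍ} {W : Matrix (Fin n) (Fin m) ℍ}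
    (hX : IsWDrazin A W X) {k : ℕ} (hk : k = max (qindex (A * W)) (qindex (W * A))) :
    X * (W * A) ^ (k + 2) = A * (W * A) ^ k := by
  have h₁ := hX.1
  rw [← hk] at h₁
  rw [hX.mul_pow_eq, pow_succ, Matrix.mul_assoc, hX.2.2, ← Matrix.mul_assoc, ← Matrix.mul_assoc,
    h₁, mul_pow_mul_eq]

lemma IsWDrazin.eq_pow_mul_mul_pow {A X : Matrix (Fin m) (Fin n) ℍ}
    {W : Matrix (Fin n) (Fin m) ℍ} (hX : IsWDrazin A W X) (p : ℕ) :
    X = (X * W) ^ p * X * (W * A) ^ p := by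
  induction p with
  | zero => rw [pow_zero, pow_zero, Matrix.one_mul, Matrix.mul_one]
  | succ p ih =>
    have h : X = X * W * (X * (W * A)) := by
      rw [← Matrix.mul_assoc X W A, ← hX.2.2]
      nth_rw 1 [← hX.2.1]
      simp only [Matrix.mul_assoc]
    nth_rw 1 [ih]
    nth_rw 2 [h]
    rw [pow_succ (X * W), pow_succ' (W * A)]
    simp only [Matrix.mul_assoc]

end WeightedDrazin

/-- Determinantal representation of the W-weighted Drazin
inverse when `WA` is Hermitian. -/
theorem wdrazin_det_representation_WA_hermitian {m n : ℕ} (k r : ℕ)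
    (A : Matrix (Fin m) (Fin n) ℍ) (W : Matrix (Fin n) (Fin m) ℍ)
    (hherm : (W * A)ᴴ = W * A)
    (hk : k = max (qindex (A * W)) (qindex (W * A)))
    (hr1 : qrank ((W * A) ^ (k + 1)) = r) (hr2 : qrank ((W * A) ^ k) = r)
    (X : Matrix (Fin m) (Fin n) ℍ) (hX : IsWDrazin A W X)
    (i : Fin m) (j : Fin n) :
    X i j =
      (∑ α ∈ (Finset.powersetCard r (Finset.univ : Finset (Fin n))).filter
          (fun α => j ∈ α),
        minorRdet (((W * A) ^ (k + 2)).updateRow j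
          (fun c => (A * (W * A) ^ k) i c)) α j) /
      (∑ α ∈ Finset.powersetCard r (Finset.univ : Finset (Fin n)),
        minorDet ((W * A) ^ (k + 2)) α) := by
  set G := (W * A) ^ (k + 2) with hG
  have hGH : Gᴴ = G := by rw [hG, Matrix.conjTranspose_pow, hherm]
  have hrank : qrank G = r := by rw [hG, qrank_pow_add_two_eq (hr1.trans hr2.symm), hr2]
  obtain ⟨hd, h₀⟩ := minorSum_qrank_ne_zero_and_mul_coefMat_eq_zero hGH
  rw [hrank] at hd h₀
  have hXC : X * coefMat G (r + 1) = 0 := by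
    rw [hX.eq_pow_mul_mul_pow (k + 2), ← hG, Matrix.mul_assoc, h₀, Matrix.mul_zero]
  have hnum : ∑ α ∈ (Finset.powersetCard r (Finset.univ : Finset (Fin n))).filter
      (fun α => j ∈ α), minorRdet (G.updateRow j (fun c => (A * (W * A) ^ k) i c)) α j =
      X i j * ((minorSum G r : ℝ) : ℍ) := by
    have h := congrArg (fun Y => (X * Y) i j) (mul_coefMat_add_coefMat hGH r)
    simp only [Matrix.mul_add, hXC, add_zero, Matrix.mul_smul, Matrix.mul_one,
      ← Matrix.mul_assoc X G] at h
    rw [hX.mul_pow_add_two hk, Matrix.mul_apply, sum_mul_coefMat, Matrix.smul_apply,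
      Algebra.smul_def, Algebra.commutes] at h
    rw [quaternion_coe_eq_algebraMap, ← h]
    exact Finset.sum_congr rfl fun α hα =>
      minorRdet_updateRow_eq α hGH _ (Finset.mem_filter.1 hα).2
  have hden : ∑ α ∈ Finset.powersetCard r (Finset.univ : Finset (Fin n)), minorDet G α =
      ((minorSum G r : ℝ) : ℍ) := by
    rw [minorSum, quaternion_coe_eq_algebraMap, map_sum]
    exact Finset.sum_congr rfl fun α _ => minorDet_eq α hGH
  have hd' : ((minorSum G r : ℝ) : ℍ) ≠ 0 := by
    rw [quaternion_coe_eq_algebraMap]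
    exact (map_ne_zero _).2 hd
  rw [hnum, hden, mul_div_cancel_right₀ _ hd']
end
end

section
/- Let A ∈ ℍ^{m×n}, W ∈ ℍ^{n×m} with k = max{Ind(AW), Ind(WA)}, and let D ∈ ℍ^{n×p}. If every column of D lies in the right column space R_r((WA)^k), then X = A_{d,W} D satisfies W A W X = D, and it is the unique solution X ∈ ℍ^{m×p} of W A W X = D whose columns all lie in the right column space R_r((AW)^k). -/
open Matrix
open scoped Classical

noncomputable section

local notation "ℍ" => Quaternion ℝ

theorem exists_eq_mul_of_forall_mulVec {R : Type*} [Semiring R] {m n p : ℕ}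
    {M : Matrix (Fin m) (Fin n) R} {D : Matrix (Fin m) (Fin p) R}
    (h : ∀ j : Fin p, ∃ y : Fin n → R, (fun i => D i j) = M.mulVec y) :
    ∃ Y : Matrix (Fin n) (Fin p) R, D = M * Y := by
  choose y hy using h
  refine ⟨fun i j => y j i, ?_⟩
  ext i j : 2
  exact congrFun (hy j) i

theorem span_rows_mul_le {R : Type*} [Semiring R] {l m n : ℕ}
    (Z : Matrix (Fin l) (Fin m) R) (M : Matrix (Fin m) (Fin n) R) :
    Submodule.span R (Set.range (Z * M)) ≤ Submodule.span R (Set.range M) := by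
  rw [Submodule.span_le]
  rintro _ ⟨i, rfl⟩
  have h : (Z * M) i = ∑ j, Z i j • M j := by
    ext t : 1
    simp [Matrix.mul_apply]
  rw [h]
  exact Submodule.sum_mem _ fun j _ =>
    Submodule.smul_mem _ _ (Submodule.subset_span (Set.mem_range_self j))

theorem exists_eq_mul_of_span_rows_le {R : Type*} [Semiring R] {l m n : ℕ}
    {N : Matrix (Fin l) (Fin n) R} {M : Matrix (Fin m) (Fin n) R}
    (h : Submodule.span R (Set.range N) ≤ Submodule.span R (Set.range M)) :
    ∃ Z : Matrix (Fin l) (Fin m) R, N = Z * M := by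
  have h' : ∀ i, ∃ c : Fin m → R, ∑ j, c j • M j = N i := fun i =>
    (Submodule.mem_span_range_iff_exists_fun R).1 (h (Submodule.subset_span ⟨i, rfl⟩))
  choose c hc using h'
  refine ⟨Matrix.of c, ?_⟩
  ext i t : 2
  rw [← hc i]
  simp [Matrix.mul_apply]

theorem qrank_mul_le {l m n : ℕ} (Z : Matrix (Fin l) (Fin m) ℍ) (M : Matrix (Fin m) (Fin n) ℍ) :
    qrank (Z * M) ≤ qrank M :=
  Submodule.finrank_mono (span_rows_mul_le Z M)

theorem qrank_pow_qindex_succ {n : ℕ} (M : Matrix (Fin n) (Fin n) ℍ) :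
    qrank (M ^ (qindex M + 1)) = qrank (M ^ qindex M) := by
  have hanti : Antitone fun k => qrank (M ^ k) := antitone_nat_of_succ_le fun k => by
    rw [pow_succ']
    exact qrank_mul_le _ _
  have hne : {k | qrank (M ^ (k + 1)) = qrank (M ^ k)}.Nonempty := by
    obtain ⟨k, hk⟩ := WellFoundedGT.monotone_chain_condition
      (⟨_, hanti.dual_right⟩ : ℕ →o ℕᵒᵈ)
    exact ⟨k, (hk (k + 1) k.le_succ).symm⟩
  exact Nat.sInf_mem hne

theorem exists_pow_eq_mul_pow_succ {n k : ℕ} (M : Matrix (Fin n) (Fin n) ℍ) (hk : qindex M ≤ k) :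
    ∃ Z : Matrix (Fin n) (Fin n) ℍ, M ^ k = Z * M ^ (k + 1) := by
  have hle : Submodule.span ℍ (Set.range (M ^ (qindex M + 1))) ≤
      Submodule.span ℍ (Set.range (M ^ qindex M)) := by
    rw [pow_succ']
    exact span_rows_mul_le _ _
  obtain ⟨Z, hZ⟩ := exists_eq_mul_of_span_rows_le
    (Submodule.eq_of_le_of_finrank_eq hle (qrank_pow_qindex_succ M)).ge
  obtain ⟨j, rfl⟩ := Nat.exists_eq_add_of_le hk
  refine ⟨Z, ?_⟩
  rw [pow_add, add_right_comm, pow_add, ← Matrix.mul_assoc, ← hZ]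

theorem pow_mul_comm_mul {R : Type*} [Semiring R] {m n : ℕ} (A : Matrix (Fin m) (Fin n) R)
    (W : Matrix (Fin n) (Fin m) R) (k : ℕ) : (W * A) ^ k * W = W * (A * W) ^ k := by
  induction k with
  | zero => simp
  | succ k ih =>
    rw [pow_succ', pow_succ', Matrix.mul_assoc (W * A), ih]
    simp only [Matrix.mul_assoc]

theorem eq_pow_mul_mul_pow {R : Type*} [Semiring R] {m n : ℕ} {B : Matrix (Fin m) (Fin m) R}
    {G : Matrix (Fin m) (Fin n) R} {C : Matrix (Fin n) (Fin n) R} (h : B * G * C = G) (k : ℕ) :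
    B ^ k * G * C ^ k = G := by
  induction k with
  | zero => simp
  | succ k ih =>
    calc B ^ (k + 1) * G * C ^ (k + 1) = B ^ k * (B * G * C) * C ^ k := by
          rw [pow_succ, pow_succ']
          simp only [Matrix.mul_assoc]
      _ = G := by rw [h, ih]

theorem IsWDrazin.mul_mul_pow {m n k : ℕ} {A : Matrix (Fin m) (Fin n) ℍ}
    {W : Matrix (Fin n) (Fin m) ℍ} {G : Matrix (Fin m) (Fin n) ℍ} (hG : IsWDrazin A W G)
    (hk : k = max (qindex (A * W)) (qindex (W * A))) :
    A * W * (G * W) * (A * W) ^ k = (A * W) ^ k := by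
  obtain ⟨h, -, hc⟩ := hG
  rw [← hk] at h
  have hcomm : Commute (A * W) (G * W) := by
    change A * W * (G * W) = G * W * (A * W)
    rw [← Matrix.mul_assoc, hc]
    simp only [Matrix.mul_assoc]
  rw [Matrix.mul_assoc, (hcomm.symm.pow_right k).eq, ← Matrix.mul_assoc, ← pow_succ',
    ← Matrix.mul_assoc, h]

theorem IsWDrazin.mul_mul_pow' {m n k : ℕ} {A : Matrix (Fin m) (Fin n) ℍ}
    {W : Matrix (Fin n) (Fin m) ℍ} {G : Matrix (Fin m) (Fin n) ℍ} (hG : IsWDrazin A W G)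
    (hk : k = max (qindex (A * W)) (qindex (W * A))) :
    W * A * (W * G) * (W * A) ^ k = (W * A) ^ k := by
  obtain ⟨h, -, hc⟩ := hG
  rw [← hk] at h
  have hcomm : Commute (W * A) (W * G) := by
    change W * A * (W * G) = W * G * (W * A)
    calc W * A * (W * G) = W * (A * W * G) := by simp only [Matrix.mul_assoc]
      _ = W * G * (W * A) := by rw [hc]; simp only [Matrix.mul_assoc]
  obtain ⟨Z, hZ⟩ := exists_pow_eq_mul_pow_succ (W * A) (hk ▸ le_max_right _ _ : _ ≤ k)
  have hsucc : (W * A) ^ (k + 1) * (W * A * (W * G)) = (W * A) ^ (k + 1) := by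
    calc (W * A) ^ (k + 1) * (W * A * (W * G))
        = (W * A) ^ (k + 1) * W * (A * W * G) := by simp only [Matrix.mul_assoc]
      _ = W * ((A * W) ^ (k + 1) * G * W) * A := by
          rw [pow_mul_comm_mul, hc]
          simp only [Matrix.mul_assoc]
      _ = (W * A) ^ (k + 1) := by
          rw [h, ← pow_mul_comm_mul, Matrix.mul_assoc, pow_succ]
  have hc' : Commute (W * A * (W * G)) ((W * A) ^ k) :=
    ((Commute.refl (W * A)).mul_left hcomm.symm).pow_right k
  rw [hc'.eq, hZ, Matrix.mul_assoc, hsucc]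

/-- The W-weighted Drazin inverse solution of the restricted
matrix equation `WAWX = D`. -/
theorem wdrazin_solution_WAWX {m n p : ℕ} (k : ℕ) (A : Matrix (Fin m) (Fin n) ℍ)
    (W : Matrix (Fin n) (Fin m) ℍ)
    (hk : k = max (qindex (A * W)) (qindex (W * A)))
    (D : Matrix (Fin n) (Fin p) ℍ)
    (hD : ∀ j : Fin p, ∃ y : Fin n → ℍ, (fun i => D i j) = ((W * A) ^ k).mulVec y)
    (G : Matrix (Fin m) (Fin n) ℍ) (hG : IsWDrazin A W G) :
    W * A * W * (G * D) = D ∧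
    (∀ j : Fin p, ∃ y : Fin m → ℍ,
      (fun i => (G * D) i j) = ((A * W) ^ k).mulVec y) ∧
    (∀ X : Matrix (Fin m) (Fin p) ℍ, W * A * W * X = D →
      (∀ j : Fin p, ∃ y : Fin m → ℍ, (fun i => X i j) = ((A * W) ^ k).mulVec y) →
      X = G * D) := by
  have hA := hG.mul_mul_pow hk
  have hW := hG.mul_mul_pow' hk
  obtain ⟨-, hGG, hc⟩ := hG
  refine ⟨?_, fun j => ?_, fun X hX hXr => ?_⟩
  · obtain ⟨Y, rfl⟩ := exists_eq_mul_of_forall_mulVec hD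
    calc W * A * W * (G * ((W * A) ^ k * Y)) = W * A * (W * G) * (W * A) ^ k * Y := by
          simp only [Matrix.mul_assoc]
      _ = (W * A) ^ k * Y := by rw [hW]
  · have hG' : A * W * G * (W * G) = G := by
      rw [hc, ← Matrix.mul_assoc, hGG]
    have hGD : G * D = (A * W) ^ k * (G * (W * G) ^ k * D) := by
      conv_lhs => rw [← eq_pow_mul_mul_pow hG' k]
      simp only [Matrix.mul_assoc]
    exact ⟨fun i => (G * (W * G) ^ k * D) i j, funext fun i => congrFun (congrFun hGD i) j⟩
  · obtain ⟨Y, rfl⟩ := exists_eq_mul_of_forall_mulVec hXr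
    rw [← hX]
    calc (A * W) ^ k * Y = A * W * (G * W) * (A * W) ^ k * Y := by rw [hA]
      _ = A * W * G * W * ((A * W) ^ k * Y) := by simp only [Matrix.mul_assoc]
      _ = G * (W * A * W * ((A * W) ^ k * Y)) := by
          rw [hc]
          simp only [Matrix.mul_assoc]
end
end
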